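/- arXiv:1107.0770 — 14 statements merged into one kernel-verified Lean document; each statement's English description precedes it below -/
import Mathlib

section
/- Let a, b ∈ ℂ with a ≠ 1 and a ≠ b, let m ≥ 3 be an integer, and let P ∈ ℂ[x,y] be a homogeneous polynomial of degree m satisfying equation (E) and such that P(λ, 0) = 0 for all λ ∈ ℂ. Then there exists a homogeneous symmetric polynomial S ∈ ℂ[x,y] of degree m − 3 (S(x,y) = S(y,x)) such that P(λ₁, λ₂) = λ₁²·λ₂·S(λ₁, λ₂). -/
open MvPolynomial

/-- Evaluation of a bivariate polynomial at a pair of complex numbers. -/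
noncomputable def ev2 (P : MvPolynomial (Fin 2) ℂ) (x y : ℂ) : ℂ :=
  MvPolynomial.eval ![x, y] P

/-- Two bivariate complex polynomials with the same values are equal. -/
theorem eq_of_ev2_eq {P Q : MvPolynomial (Fin 2) ℂ} (h : ∀ x y, ev2 P x y = ev2 Q x y) :
    P = Q := by
  refine MvPolynomial.funext fun v => ?_
  have hv : v = ![v 0, v 1] := by
    ext i
    fin_cases i <;> rfl
  rw [hv]
  exact h (v 0) (v 1)

/-- The values of `rename (Equiv.swap 0 1) P` are those of `P` with the arguments swapped. -/
theorem ev2_rename_swap (P : MvPolynomial (Fin 2) ℂ) (x y : ℂ) :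
    ev2 (rename (Equiv.swap 0 1) P) x y = ev2 P y x := by
  have hv : ![x, y] ∘ Equiv.swap (0 : Fin 2) 1 = ![y, x] := by
    ext i
    fin_cases i <;> simp
  rw [ev2, eval_rename, hv, ev2]

/-- A bivariate polynomial vanishing on the first axis is divisible by the second variable. -/
theorem X_one_dvd_of_ev2_zero {P : MvPolynomial (Fin 2) ℂ} (h : ∀ x, ev2 P x 0 = 0) :
    (X 1 : MvPolynomial (Fin 2) ℂ) ∣ P := by
  have hzero : aeval ![(X 0 : MvPolynomial (Fin 2) ℂ), 0] P = 0 := by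
    refine eq_of_ev2_eq fun x y => ?_
    have hcomp : ((aeval ![x, y]).comp (aeval ![(X 0 : MvPolynomial (Fin 2) ℂ), 0]) :
        MvPolynomial (Fin 2) ℂ →ₐ[ℂ] ℂ) = aeval ![x, 0] := by
      refine MvPolynomial.algHom_ext fun i => ?_
      fin_cases i <;> simp
    have hP := DFunLike.congr_fun hcomp P
    simp only [AlgHom.comp_apply, aeval_eq_eval] at hP
    simpa [ev2] using hP.trans (h x)
  have hcomp : (Ideal.Quotient.mkₐ ℂ (Ideal.span {(X 1 : MvPolynomial (Fin 2) ℂ)})).comp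
      (aeval ![(X 0 : MvPolynomial (Fin 2) ℂ), 0]) = Ideal.Quotient.mkₐ ℂ _ := by
    refine MvPolynomial.algHom_ext fun i => ?_
    fin_cases i <;> simp
  have hP := DFunLike.congr_fun hcomp P
  rw [AlgHom.comp_apply, hzero, map_zero] at hP
  exact Ideal.mem_span_singleton.mp (Ideal.Quotient.eq_zero_iff_mem.mp hP.symm)

/-- A bivariate polynomial vanishing on the second axis is divisible by the first variable. -/
theorem X_zero_dvd_of_ev2_zero {P : MvPolynomial (Fin 2) ℂ} (h : ∀ y, ev2 P 0 y = 0) :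
    (X 0 : MvPolynomial (Fin 2) ℂ) ∣ P := by
  obtain ⟨Q, hQ⟩ := X_one_dvd_of_ev2_zero (P := rename (Equiv.swap 0 1) P)
    fun x => (ev2_rename_swap P x 0).trans (h x)
  refine ⟨rename (Equiv.swap 0 1) Q, eq_of_ev2_eq fun x y => ?_⟩
  rw [← ev2_rename_swap, hQ]
  have hswap := ev2_rename_swap Q x y
  simp only [ev2, map_mul, eval_X, Matrix.cons_val_zero, Matrix.cons_val_one] at *
  rw [hswap]

/-- If `X i * P` is homogeneous of degree `n + 1` then `P` is homogeneous of degree `n`. -/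
theorem isHomogeneous_of_X_mul {σ R : Type*} [CommSemiring R] {i : σ} {P : MvPolynomial σ R}
    {n : ℕ} (h : (X i * P).IsHomogeneous (n + 1)) : P.IsHomogeneous n := by
  intro d hd
  have hdeg := @h (Finsupp.single i 1 + d) (by rwa [coeff_X_mul])
  rw [map_add, Finsupp.weight_single] at hdeg
  simp only [Pi.one_apply, smul_eq_mul, mul_one] at hdeg
  omega

/-- A polynomial is symmetric as soon as its product with `X 0 * X 1` is. -/
theorem ev2_symm_of_mul_symm {Q : MvPolynomial (Fin 2) ℂ}
    (h : ∀ x y, x * y * ev2 Q x y = x * y * ev2 Q y x) (x y : ℂ) : ev2 Q x y = ev2 Q y x := by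
  have hmul : X 0 * (X 1 * Q) = X 0 * (X 1 * rename (Equiv.swap 0 1) Q) := by
    refine eq_of_ev2_eq fun x y => ?_
    have hxy := h x y
    have hswap := ev2_rename_swap Q x y
    simp only [ev2, map_mul, eval_X, Matrix.cons_val_zero, Matrix.cons_val_one] at *
    linear_combination hxy - x * y * hswap
  have hQ := mul_left_cancel₀ (X_ne_zero _) (mul_left_cancel₀ (X_ne_zero _) hmul)
  rw [← ev2_rename_swap, ← hQ]

theorem stmt2 (a b : ℂ) (ha : a ≠ 1) (hab : a ≠ b) (m : ℕ) (hm : 3 ≤ m)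
    (P : MvPolynomial (Fin 2) ℂ) (hhom : P.IsHomogeneous m)
    (hE : ∀ l1 l2 l3 : ℂ,
      ((b - 1) * l1 - l2 - l3) * ev2 P l2 l3
        - (-l1 + (b - 1) * l2 - l3) * ev2 P l1 l3
        - (l1 - l2) * ev2 P (l1 + l2) l3
        - ((a - 1) * l1 - l3) * ev2 P l2 (l1 + l3)
        + ((a - 1) * l2 - l3) * ev2 P l1 (l2 + l3) = 0)
    (hP0 : ∀ lam : ℂ, ev2 P lam 0 = 0) :
    ∃ S : MvPolynomial (Fin 2) ℂ, S.IsHomogeneous (m - 3) ∧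
      (∀ x y : ℂ, ev2 S x y = ev2 S y x) ∧
      (∀ l1 l2 : ℂ, ev2 P l1 l2 = l1 ^ 2 * l2 * ev2 S l1 l2) := by
  have hsymm (x y : ℂ) : y * ev2 P x y = x * ev2 P y x := by
    have h := hE x y 0
    simp only [hP0, add_zero] at h
    refine mul_left_cancel₀ (sub_ne_zero.mpr ha) ?_
    linear_combination h
  have hP0' (y : ℂ) : ev2 P 0 y = 0 := by
    rcases eq_or_ne y 0 with rfl | hy
    · exact hP0 0
    · simpa [hy] using hsymm 0 y
  obtain ⟨Q, rfl⟩ := X_zero_dvd_of_ev2_zero hP0'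
  have hX0 (F : MvPolynomial (Fin 2) ℂ) (x y : ℂ) : ev2 (X 0 * F) x y = x * ev2 F x y := by
    simp [ev2]
  have hX1 (F : MvPolynomial (Fin 2) ℂ) (x y : ℂ) : ev2 (X 1 * F) x y = y * ev2 F x y := by
    simp [ev2]
  have hQsymm := ev2_symm_of_mul_symm (Q := Q) fun x y => by
    have hxy := hsymm x y
    rw [hX0, hX0] at hxy
    linear_combination hxy
  obtain ⟨R, rfl⟩ : X 1 ∣ Q :=
    (X_prime.dvd_or_dvd (X_one_dvd_of_ev2_zero hP0)).resolve_left (by simp [X_dvd_X])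
  obtain ⟨S, rfl⟩ : X 0 ∣ R := by
    refine (X_prime.dvd_or_dvd (X_zero_dvd_of_ev2_zero fun y => ?_)).resolve_left
      (by simp [X_dvd_X] : ¬ (X 0 : MvPolynomial (Fin 2) ℂ) ∣ X 1)
    rw [hQsymm, hX1, zero_mul]
  refine ⟨S, ?_, ev2_symm_of_mul_symm fun x y => ?_, fun x y => ?_⟩
  · obtain ⟨n, rfl⟩ := Nat.exists_eq_add_of_le' hm
    exact isHomogeneous_of_X_mul (isHomogeneous_of_X_mul (isHomogeneous_of_X_mul hhom))
  · have hxy := hQsymm x y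
    simp only [hX0, hX1] at hxy
    linear_combination hxy
  · simp only [hX0, hX1]
    ring
end

section
/- Let a, b ∈ ℂ with a ≠ 1 and a ≠ b, let m ≥ 3 be an integer with a − b ≠ m − 1, and let P ∈ ℂ[x,y] be a homogeneous polynomial of degree m satisfying equation (E) and such that P(λ, 0) = 0 for all λ ∈ ℂ. Then P = 0. -/
open MvPolynomial

/-- The derivative of the evaluation of a polynomial along a curve. -/
theorem MvPolynomial.hasDerivAt_eval {σ : Type*} [Fintype σ] (P : MvPolynomial σ ℂ)
    {c : ℂ → σ → ℂ} {c' : σ → ℂ} {t : ℂ} (hc : ∀ i, HasDerivAt (fun s => c s i) (c' i) t) :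
    HasDerivAt (fun s => eval (c s) P) (∑ i, c' i * eval (c t) (pderiv i P)) t := by
  classical
  induction P using MvPolynomial.induction_on with
  | C r => simpa using hasDerivAt_const t r
  | add p q hp hq =>
    simp only [map_add, mul_add, Finset.sum_add_distrib]
    exact hp.add hq
  | mul_X p j hp =>
    have h := hp.mul (hc j)
    simp only [map_mul, eval_X]
    refine h.congr_deriv ?_
    simp only [Derivation.leibniz, smul_eq_mul, map_add, map_mul, eval_X, pderiv_X, mul_add,
      Finset.sum_add_distrib, Pi.single_apply, apply_ite (eval (c t)), map_zero,
      mul_ite, mul_one, mul_zero, Finset.sum_ite_eq, Finset.mem_univ, if_true, Finset.sum_mul]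
    rw [add_comm, mul_comm (c' j)]
    congr 1
    exact Finset.sum_congr rfl fun i _ => by ring

theorem hasDerivAt_ev2 (P : MvPolynomial (Fin 2) ℂ) {f g : ℂ → ℂ} {f' g' t : ℂ}
    (hf : HasDerivAt f f' t) (hg : HasDerivAt g g' t) :
    HasDerivAt (fun s => ev2 P (f s) (g s))
      (f' * ev2 (pderiv 0 P) (f t) (g t) + g' * ev2 (pderiv 1 P) (f t) (g t)) t := by
  have h := MvPolynomial.hasDerivAt_eval P (c := fun s => ![f s, g s]) (c' := ![f', g']) (t := t)
    (by intro i; fin_cases i <;> simpa)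
  simpa [ev2, Fin.sum_univ_two] using h

/-- Euler's identity for bivariate homogeneous polynomials, evaluated at a point. -/
theorem MvPolynomial.IsHomogeneous.ev2_euler {P : MvPolynomial (Fin 2) ℂ} {m : ℕ}
    (hP : P.IsHomogeneous m) (x y : ℂ) :
    x * ev2 (pderiv 0 P) x y + y * ev2 (pderiv 1 P) x y = m * ev2 P x y := by
  have h := congrArg (eval ![x, y]) hP.sum_X_mul_pderiv
  simpa [ev2, Fin.sum_univ_two, nsmul_eq_mul] using h

theorem stmt3 (a b : ℂ) (ha : a ≠ 1) (hab : a ≠ b) (m : ℕ) (hm : 3 ≤ m)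
    (hmab : a - b ≠ (m : ℂ) - 1)
    (P : MvPolynomial (Fin 2) ℂ) (hhom : P.IsHomogeneous m)
    (hE : ∀ l1 l2 l3 : ℂ,
      ((b - 1) * l1 - l2 - l3) * ev2 P l2 l3
        - (-l1 + (b - 1) * l2 - l3) * ev2 P l1 l3
        - (l1 - l2) * ev2 P (l1 + l2) l3
        - ((a - 1) * l1 - l3) * ev2 P l2 (l1 + l3)
        + ((a - 1) * l2 - l3) * ev2 P l1 (l2 + l3) = 0)
    (hP0 : ∀ lam : ℂ, ev2 P lam 0 = 0) :
    P = 0 := by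
  have hswap (x y : ℂ) : y * ev2 P x y = x * ev2 P y x := by
    have h := hE x y 0
    simp only [hP0, add_zero, sub_zero, mul_zero, zero_sub] at h
    refine mul_left_cancel₀ (sub_ne_zero.2 ha) ?_
    linear_combination h
  have hzero (y : ℂ) : y * ev2 P 0 y = 0 := by simpa using hswap 0 y
  have hderiv (y : ℂ) : y * ev2 (pderiv 0 P) 0 y = 0 := by
    have h1 := (hasDerivAt_ev2 P (hasDerivAt_id 0) (hasDerivAt_const 0 y)).const_mul y
    have h2 := (hasDerivAt_id (0 : ℂ)).mul
      (hasDerivAt_ev2 P (hasDerivAt_const 0 y) (hasDerivAt_id 0))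
    have h3 := h1.unique (h2.congr_of_eventuallyEq (.of_forall fun t => hswap t y))
    simpa [hP0] using h3
  have hmul (x y : ℂ) : y * (x + y) * ev2 P x y = 0 := by
    have ht := hasDerivAt_id (0 : ℂ)
    have hk (z : ℂ) := hasDerivAt_const (0 : ℂ) z
    have h := ((((((ht.const_mul (b - 1)).sub (hk x)).sub (hk y)).mul (hk (ev2 P x y))).sub
      (((ht.neg.add (hk ((b - 1) * x))).sub (hk y)).mul (hasDerivAt_ev2 P ht (hk y)))).sub
      ((ht.sub (hk x)).mul (hasDerivAt_ev2 P (ht.add (hk x)) (hk y)))).sub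
      (((ht.const_mul (a - 1)).sub (hk y)).mul (hasDerivAt_ev2 P (hk x) (ht.add (hk y)))) |>.add
      ((hk ((a - 1) * x - y)).mul (hasDerivAt_ev2 P ht (hk (x + y))))
    have h0 := h.unique ((hk 0).congr_of_eventuallyEq (.of_forall fun t => hE t x y))
    simp at h0
    refine mul_left_cancel₀ (sub_ne_zero.2 hmab) ?_
    linear_combination (-y * (x + y)) * h0 + y * (x + y) * hhom.ev2_euler x y + (x + y) * hzero y
      - (x + y) * ((b - 1) * x - y) * hderiv y + y * ((a - 1) * x - y) * hderiv (x + y)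
  have hprod : X 1 * (X 0 + X 1) * P = 0 := by
    refine MvPolynomial.funext fun v => ?_
    have hv : v = ![v 0, v 1] := by ext i; fin_cases i <;> rfl
    rw [hv]
    simpa [ev2] using hmul (v 0) (v 1)
  refine (mul_eq_zero.1 hprod).resolve_left (mul_ne_zero (X_ne_zero 1) fun h => ?_)
  simpa using congrArg (eval ![0, 1]) h
end

section
/- Let a, b ∈ ℂ with a ≠ 1 and a ≠ b, let m ≥ 8 be an integer with a − b = m − 1, and let P ∈ ℂ[x,y] be a homogeneous polynomial of degree m satisfying equation (E) and such that P(λ, 0) = 0 for all λ ∈ ℂ. Then P = 0. -/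
open MvPolynomial

/-- A polynomial over `ℂ` all of whose values vanish has vanishing coefficients. -/
theorem coeff_eq_zero_of_eval_eq_zero (F : Polynomial ℂ) (h : ∀ t, F.eval t = 0) (k : ℕ) :
    F.coeff k = 0 := by
  have hF : F = 0 := Polynomial.funext fun t => by rw [h t, Polynomial.eval_zero]
  rw [hF, Polynomial.coeff_zero]

/-- The values of a binary form are given by a sequence of coefficients. -/
theorem exists_coeff_ev2 {m : ℕ} {P : MvPolynomial (Fin 2) ℂ} (hP : P.IsHomogeneous m) :
    ∃ p : ℕ → ℂ, ∀ x y,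
      ev2 P x y = ∑ i ∈ Finset.range (m + 1), p i * x ^ (m - i) * y ^ i := by
  have hdeg : ∀ d ∈ P.support, d 0 + d 1 = m := by
    intro d hd
    have h := hP (MvPolynomial.mem_support_iff.mp hd)
    rwa [Finsupp.weight_apply, Finsupp.sum_fintype _ _ (by simp), Fin.sum_univ_two,
      Pi.one_apply, Pi.one_apply, smul_eq_mul, smul_eq_mul, mul_one, mul_one] at h
  refine ⟨fun i => ∑ d ∈ P.support with d 1 = i, P.coeff d, fun x y => ?_⟩
  have hmaps : ∀ d ∈ P.support, d 1 ∈ Finset.range (m + 1) := fun d hd => by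
    have := hdeg d hd
    rw [Finset.mem_range]
    omega
  rw [ev2, MvPolynomial.eval_eq', ← Finset.sum_fiberwise_of_maps_to hmaps]
  refine Finset.sum_congr rfl fun i _ => ?_
  rw [Finset.sum_mul, Finset.sum_mul]
  refine Finset.sum_congr rfl fun d hd => ?_
  obtain ⟨hdP, rfl⟩ := Finset.mem_filter.mp hd
  have h0 : d 0 = m - d 1 := by have := hdeg d hdP; omega
  rw [Fin.prod_univ_two, h0]
  simp [mul_assoc]

theorem coeff_sum_C_mul_X_pow_sub {m k : ℕ} (f : ℕ → ℂ) (hk : k ≤ m) :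
    (∑ i ∈ Finset.range (m + 1), Polynomial.C (f i) * Polynomial.X ^ (m - i)).coeff k
      = f (m - k) := by
  rw [Polynomial.finsetSum_coeff, Finset.sum_eq_single (m - k)]
  · rw [Polynomial.coeff_C_mul_X_pow, if_pos (by omega)]
  · intro i hi hne
    rw [Finset.mem_range] at hi
    rw [Polynomial.coeff_C_mul_X_pow, if_neg (by omega)]
  · intro hk'
    rw [Finset.mem_range] at hk'
    omega

theorem coeff_sum_C_mul_X_pow_tsub {m j k : ℕ} (f : ℕ → ℂ) (hf : ∀ i < k, f i = 0)
    (hk : j + k ≤ m) :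
    (∑ i ∈ Finset.range (m + 1), Polynomial.C (f i) * Polynomial.X ^ (i - k)).coeff j
      = f (j + k) := by
  rw [Polynomial.finsetSum_coeff, Finset.sum_eq_single (j + k)]
  · rw [Polynomial.coeff_C_mul_X_pow, if_pos (by omega)]
  · intro i _ hne
    rw [Polynomial.coeff_C_mul_X_pow]
    split_ifs with h
    · exact hf i (by omega)
    · rfl
  · intro hk'
    rw [Finset.mem_range] at hk'
    omega

theorem coeff_linear_mul (α β : ℂ) (F : Polynomial ℂ) (k : ℕ) :
    ((Polynomial.C α * Polynomial.X + Polynomial.C β) * F).coeff (k + 1)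
      = α * F.coeff k + β * F.coeff (k + 1) := by
  rw [add_mul, Polynomial.coeff_add, mul_assoc, Polynomial.coeff_C_mul, Polynomial.coeff_X_mul,
    Polynomial.coeff_C_mul]

/-- The functional equation at `l3 = 0` is a reflection symmetry of the coefficients. -/
theorem coeff_reflect {m : ℕ} {p : ℕ → ℂ}
    (h : ∀ y : ℂ, ∑ i ∈ Finset.range (m + 1), p i * y ^ (m - i)
      = y * ∑ i ∈ Finset.range (m + 1), p i * y ^ i) :
    p m = 0 ∧ ∀ i j, i + j + 1 = m → p i = p j := by
  have key := coeff_eq_zero_of_eval_eq_zero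
    (∑ i ∈ Finset.range (m + 1), Polynomial.C (p i) * Polynomial.X ^ (m - i)
      - Polynomial.X * ∑ i ∈ Finset.range (m + 1), Polynomial.C (p i) * Polynomial.X ^ i)
    (fun t => by simpa [Polynomial.eval_finsetSum, sub_eq_zero] using h t)
  refine ⟨?_, fun i j hij => ?_⟩
  · have h0 := key 0
    rw [Polynomial.coeff_sub, coeff_sum_C_mul_X_pow_sub p (Nat.zero_le m), Polynomial.coeff_X_mul_zero] at h0
    simpa using h0
  · have h1 := key (j + 1)
    rw [Polynomial.coeff_sub, coeff_sum_C_mul_X_pow_sub p (show j + 1 ≤ m by omega), Polynomial.coeff_X_mul, Polynomial.finsetSum_coeff,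
      show m - (j + 1) = i by omega] at h1
    have : ∑ k ∈ Finset.range (m + 1), (Polynomial.C (p k) * Polynomial.X ^ k : Polynomial ℂ).coeff j = p j := by
      simp only [Polynomial.coeff_C_mul_X_pow]
      rw [Finset.sum_ite_eq, if_pos (Finset.mem_range.mpr (by omega))]
    rw [this] at h1
    exact sub_eq_zero.mp h1

/-- The part of the functional equation at `l2 = 1` that is quadratic in `l1`. -/
theorem quadratic_part {m : ℕ} (hm : 2 ≤ m) {p : ℕ → ℂ} {S : ℂ → ℂ → ℂ} {a b : ℂ}
    (hS : ∀ x y, S x y = ∑ i ∈ Finset.range (m + 1), p i * x ^ (m - i) * y ^ i)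
    (h : ∀ x y : ℂ, ((b - 1) * x - 1 - y) * S 1 y - (-x + (b - 1) * 1 - y) * S x y
      - (x - 1) * S (x + 1) y - ((a - 1) * x - y) * S 1 (x + y)
      + ((a - 1) * 1 - y) * S x (1 + y) = 0) (y : ℂ) :
    p (m - 1) * y ^ (m - 1) - (b - 1 - y) * (p (m - 2) * y ^ (m - 2))
      - ∑ i ∈ Finset.range (m + 1), p i * (m - i).choose 1 * y ^ i
      + ∑ i ∈ Finset.range (m + 1), p i * (m - i).choose 2 * y ^ i
      - (a - 1) * ∑ i ∈ Finset.range (m + 1), p i * i.choose 1 * y ^ (i - 1)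
      + y * ∑ i ∈ Finset.range (m + 1), p i * i.choose 2 * y ^ (i - 2)
      + (a - 1 - y) * (p (m - 2) * (1 + y) ^ (m - 2)) = 0 := by
  have key := coeff_eq_zero_of_eval_eq_zero
    ((Polynomial.C (b - 1) * Polynomial.X + Polynomial.C (-1 - y)) * Polynomial.C (S 1 y)
      + (Polynomial.C 1 * Polynomial.X + Polynomial.C (-(b - 1 - y)))
        * ∑ i ∈ Finset.range (m + 1), Polynomial.C (p i * y ^ i) * Polynomial.X ^ (m - i)
      + (Polynomial.C (-1) * Polynomial.X + Polynomial.C 1)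
        * ∑ i ∈ Finset.range (m + 1),
          Polynomial.C (p i * y ^ i) * (Polynomial.X + Polynomial.C 1) ^ (m - i)
      + (Polynomial.C (-(a - 1)) * Polynomial.X + Polynomial.C y)
        * ∑ i ∈ Finset.range (m + 1),
          Polynomial.C (p i) * (Polynomial.X + Polynomial.C y) ^ i
      + (Polynomial.C 0 * Polynomial.X + Polynomial.C (a - 1 - y))
        * ∑ i ∈ Finset.range (m + 1),
          Polynomial.C (p i * (1 + y) ^ i) * Polynomial.X ^ (m - i))
    (fun t => by
      have h1 := h t y
      rw [hS t y, hS (t + 1) y, hS 1 (t + y), hS t (1 + y)] at h1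
      simp only [one_pow, mul_one, mul_right_comm _ (_ ^ (m - _))] at h1
      simp only [Polynomial.eval_add, Polynomial.eval_mul, Polynomial.eval_C, Polynomial.eval_X,
        Polynomial.eval_finsetSum, Polynomial.eval_pow]
      linear_combination h1) 2
  simp only [Polynomial.coeff_add, coeff_linear_mul,
    coeff_sum_C_mul_X_pow_sub (fun i => p i * y ^ i) (show 1 ≤ m by omega),
    coeff_sum_C_mul_X_pow_sub (fun i => p i * y ^ i) hm,
    coeff_sum_C_mul_X_pow_sub (fun i => p i * (1 + y) ^ i) (show 1 ≤ m by omega),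
    coeff_sum_C_mul_X_pow_sub (fun i => p i * (1 + y) ^ i) hm, Polynomial.finsetSum_coeff,
    Polynomial.coeff_C_mul, Polynomial.coeff_X_add_C_pow, one_pow, one_mul,
    Polynomial.coeff_C_succ] at key
  have e1 : ∀ k, ∑ i ∈ Finset.range (m + 1), p i * y ^ i * (m - i).choose k
      = ∑ i ∈ Finset.range (m + 1), p i * (m - i).choose k * y ^ i := fun k =>
    Finset.sum_congr rfl fun i _ => by ring
  have e2 : ∀ k, ∑ i ∈ Finset.range (m + 1), p i * (y ^ (i - k) * i.choose k)
      = ∑ i ∈ Finset.range (m + 1), p i * i.choose k * y ^ (i - k) := fun k =>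
    Finset.sum_congr rfl fun i _ => by ring
  rw [e1, e1, e2, e2] at key
  linear_combination key

/-- Comparing coefficients in `quadratic_part` gives a two-term recurrence. -/
theorem coeff_recurrence {m : ℕ} {p : ℕ → ℂ} {a b : ℂ}
    (h : ∀ y : ℂ, p (m - 1) * y ^ (m - 1) - (b - 1 - y) * (p (m - 2) * y ^ (m - 2))
      - ∑ i ∈ Finset.range (m + 1), p i * (m - i).choose 1 * y ^ i
      + ∑ i ∈ Finset.range (m + 1), p i * (m - i).choose 2 * y ^ i
      - (a - 1) * ∑ i ∈ Finset.range (m + 1), p i * i.choose 1 * y ^ (i - 1)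
      + y * ∑ i ∈ Finset.range (m + 1), p i * i.choose 2 * y ^ (i - 2)
      + (a - 1 - y) * (p (m - 2) * (1 + y) ^ (m - 2)) = 0)
    (j : ℕ) (hj : j + 4 ≤ m) :
    (((m : ℂ) - (j + 1)) * ((m : ℂ) - (j + 1) - 3)) * p (j + 1)
      + (j + 2) * (j + 1 - 2 * (a - 1)) * p (j + 2)
      = 2 * p (m - 2) * (-(a - 1) * (m - 2).choose (j + 1) + (m - 2).choose j) := by
  have key := coeff_eq_zero_of_eval_eq_zero
    (Polynomial.C (p (m - 1)) * Polynomial.X ^ (m - 1)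
      + (Polynomial.C 1 * Polynomial.X + Polynomial.C (-(b - 1)))
        * (Polynomial.C (p (m - 2)) * Polynomial.X ^ (m - 2))
      - ∑ i ∈ Finset.range (m + 1),
        Polynomial.C (p i * (m - i).choose 1) * Polynomial.X ^ (i - 0)
      + ∑ i ∈ Finset.range (m + 1),
        Polynomial.C (p i * (m - i).choose 2) * Polynomial.X ^ (i - 0)
      + Polynomial.C (-(a - 1)) * ∑ i ∈ Finset.range (m + 1),
        Polynomial.C (p i * i.choose 1) * Polynomial.X ^ (i - 1)
      + (Polynomial.C 1 * Polynomial.X + Polynomial.C 0) * ∑ i ∈ Finset.range (m + 1),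
        Polynomial.C (p i * i.choose 2) * Polynomial.X ^ (i - 2)
      + (Polynomial.C (-1) * Polynomial.X + Polynomial.C (a - 1))
        * (Polynomial.C (p (m - 2)) * (1 + Polynomial.X) ^ (m - 2)))
    (fun t => by
      simp only [Polynomial.eval_add, Polynomial.eval_sub, Polynomial.eval_mul, Polynomial.eval_C,
        Polynomial.eval_X, Polynomial.eval_finsetSum, Polynomial.eval_pow, Polynomial.eval_one,
        Nat.sub_zero]
      linear_combination h t) (j + 1)
  have lt_two : ∀ i < 2, p i * (i.choose 2 : ℂ) = 0 := fun i hi => by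
    rw [Nat.choose_eq_zero_of_lt hi, Nat.cast_zero, mul_zero]
  have lt_one : ∀ i < 1, p i * (i.choose 1 : ℂ) = 0 := fun i hi => by
    rw [Nat.choose_eq_zero_of_lt hi, Nat.cast_zero, mul_zero]
  simp only [Polynomial.coeff_add, Polynomial.coeff_sub, coeff_linear_mul, Polynomial.coeff_C_mul,
    coeff_sum_C_mul_X_pow_tsub (fun i => p i * (m - i).choose 1) (k := 0) (by simp)
      (show j + 1 + 0 ≤ m by omega),
    coeff_sum_C_mul_X_pow_tsub (fun i => p i * (m - i).choose 2) (k := 0) (by simp)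
      (show j + 1 + 0 ≤ m by omega),
    coeff_sum_C_mul_X_pow_tsub (fun i => p i * i.choose 1) lt_one
      (show j + 1 + 1 ≤ m by omega),
    coeff_sum_C_mul_X_pow_tsub (fun i => p i * i.choose 2) lt_two
      (show j + 2 ≤ m by omega),
    Polynomial.coeff_X_pow, Polynomial.coeff_one_add_X_pow, if_neg (show j + 1 ≠ m - 1 by omega),
    if_neg (show j + 1 ≠ m - 2 by omega), if_neg (show j ≠ m - 2 by omega)] at key
  simp only [add_zero, add_assoc, one_add_one_eq_two, Nat.choose_one_right, Nat.cast_choose_two ℂ] at key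
  rw [Nat.cast_sub (show j + 1 ≤ m by omega)] at key
  push_cast at key
  linear_combination 2 * key

/-- The five linear relations between the first four nonzero coefficients only have the
trivial solution. -/
theorem leading_coeffs_eq_zero (n : ℕ) (A M c d u v : ℂ) (hM : M = n + 8)
    (h1 : (M - 1) * (M - 4) * c + 2 * (1 - 2 * A) * d = 2 * c * (-A * (M - 2) + 1))
    (h2 : (M - 2) * (M - 5) * d + 3 * (2 - 2 * A) * u
      = 2 * c * (-A * ((M - 2) * (M - 3) / 2) + (M - 2)))
    (h3 : (M - 3) * (M - 6) * u + 4 * (3 - 2 * A) * v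
      = 2 * c * (-A * ((M - 2) * (M - 3) * (M - 4) / 6) + (M - 2) * (M - 3) / 2))
    (h4 : 4 * u + (M - 3) * (M - 4 - 2 * A) * d
      = 2 * c * (-A * ((M - 2) * (M - 3) / 2) + (M - 2) * (M - 3) * (M - 4) / 6))
    (h5 : 10 * v + (M - 4) * (M - 5 - 2 * A) * u
      = 2 * c * (-A * ((M - 2) * (M - 3) * (M - 4) / 6)
        + (M - 2) * (M - 3) * (M - 4) * (M - 5) / 24)) :
    c = 0 ∧ d = 0 := by
  have hne : ∀ k : ℕ, (n : ℂ) + k + 1 ≠ 0 := fun k => by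
    exact_mod_cast Nat.succ_ne_zero (n + k)
  have m0 : M ≠ 0 := by rw [hM]; convert hne 7 using 1; push_cast; ring
  have mp : M + 1 ≠ 0 := by rw [hM]; convert hne 8 using 1; push_cast; ring
  have m2 : M - 2 ≠ 0 := by rw [hM]; convert hne 5 using 1; push_cast; ring
  have m3 : M - 3 ≠ 0 := by rw [hM]; convert hne 4 using 1; push_cast; ring
  have m5 : M - 5 ≠ 0 := by rw [hM]; convert hne 2 using 1; push_cast; ring
  have m7 : M - 7 ≠ 0 := by rw [hM]; convert hne 0 using 1; push_cast; ring
  have hc : c = 0 := by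
    by_contra hc
    have hq : 2 * (M - 3) * A ^ 2 - (3 * M - 5) * (M - 2) / 2 * A
        + (M ^ 2 - 5 * M + 10) / 2 = 0 := by
      have : c * (M * (M - 5)) * (2 * (M - 3) * A ^ 2 - (3 * M - 5) * (M - 2) / 2 * A
        + (M ^ 2 - 5 * M + 10) / 2) = 0 := by
        linear_combination 2 * (1 - 2 * A) * h2 - 3 * (1 - A) * (1 - 2 * A) * h4
          - ((M - 2) * (M - 5) - 3 / 2 * (1 - A) * (M - 3) * (M - 4 - 2 * A)) * h1
      simpa [hc, m0, m5] using this
    have ht : A = (M ^ 3 - 10 * M ^ 2 + 31 * M - 26) / 4 := by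
      have : c * (M * (M - 7) * (M + 1) * (M - 2) * (M - 3)) *
          (A - (M ^ 3 - 10 * M ^ 2 + 31 * M - 26) / 4) = 0 := by
        linear_combination
          -30 * (M - 3) ^ 2 * ((1 - 2 * A) * h3 - 2 / 5 * (3 - 2 * A) * (1 - 2 * A) * h5
            - ((M - 3) * (M - 6) - 2 / 5 * (3 - 2 * A) * (M - 4) * (M - 5 - 2 * A))
              * ((1 - 2 * A) / 4 * h4 - (M - 3) * (M - 4 - 2 * A) / 8 * h1))
          + 60 * c * (148 / 5 * M - 119 / 3 * M ^ 2 + 311 / 15 * M ^ 3 - 53 / 10 * M ^ 4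
            + 2 / 3 * M ^ 5 - 1 / 30 * M ^ 6
            + A * (12 * M - 67 / 5 * M ^ 2 + 83 / 15 * M ^ 3 - M ^ 4 + 1 / 15 * M ^ 5)) * hq
      have := (mul_eq_zero.mp this).resolve_left (by simp [hc, m0, m7, mp, m2, m3])
      exact sub_eq_zero.mp this
    rw [ht, hM] at hq
    have : ((n ^ 7 + 33 * n ^ 6 + 459 * n ^ 5 + 3483 * n ^ 4 + 15540 * n ^ 3 + 40644 * n ^ 2
        + 57440 * n + 33600 : ℕ) : ℂ) = 0 := by
      push_cast
      linear_combination 8 * hq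
    rw [Nat.cast_eq_zero] at this
    omega
  subst hc
  refine ⟨rfl, ?_⟩
  by_contra hd
  have hA : A = 1 / 2 := by
    have : d * (1 - 2 * A) = 0 := by linear_combination h1 / 2
    have := (mul_eq_zero.mp this).resolve_left hd
    linear_combination -this / 2
  subst hA
  have : (M - 5) * (M + 1) * d = 0 := by linear_combination 4 * h2 - 3 * h4
  simp [m5, mp, hd] at this

theorem stmt4 (a b : ℂ) (ha : a ≠ 1) (hab : a ≠ b) (m : ℕ) (hm : 8 ≤ m)
    (hmab : a - b = (m : ℂ) - 1)
    (P : MvPolynomial (Fin 2) ℂ) (hhom : P.IsHomogeneous m)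
    (hE : ∀ l1 l2 l3 : ℂ,
      ((b - 1) * l1 - l2 - l3) * ev2 P l2 l3
        - (-l1 + (b - 1) * l2 - l3) * ev2 P l1 l3
        - (l1 - l2) * ev2 P (l1 + l2) l3
        - ((a - 1) * l1 - l3) * ev2 P l2 (l1 + l3)
        + ((a - 1) * l2 - l3) * ev2 P l1 (l2 + l3) = 0)
    (hP0 : ∀ lam : ℂ, ev2 P lam 0 = 0) :
    P = 0 := by
  obtain ⟨p, hS⟩ := exists_coeff_ev2 hhom
  have hp0 : p 0 = 0 := by
    have h := hP0 1
    rw [hS, Finset.sum_range_succ'] at h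
    simpa using h
  obtain ⟨hpm0, hsymm⟩ := coeff_reflect (m := m) (p := p) fun y => by
    have h := hE y 1 0
    rw [hP0, hP0, hP0, add_zero, add_zero, hS, hS] at h
    simp only [one_pow, mul_one] at h
    refine mul_left_cancel₀ (sub_ne_zero.mpr ha) ?_
    linear_combination h
  have hrec := coeff_recurrence (quadratic_part (by omega) hS fun x y => hE x 1 y)
  obtain ⟨n, rfl⟩ := Nat.exists_eq_add_of_le' hm
  have c2 := Nat.cast_choose_two ℂ (n + 6)
  have c3 : ((n + 6).choose 3 : ℂ) * 3 = (n + 6).choose 2 * (n + 4) := by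
    exact_mod_cast Nat.choose_succ_right_eq (n + 6) 2
  have c4 : ((n + 6).choose 4 : ℂ) * 4 = (n + 6).choose 3 * (n + 3) := by
    exact_mod_cast Nat.choose_succ_right_eq (n + 6) 3
  have s2 : p (n + 6) = p 1 := hsymm _ _ (by omega)
  have s3 : p (n + 5) = p 2 := hsymm _ _ (by omega)
  have s4 : p (n + 4) = p 3 := hsymm _ _ (by omega)
  have s5 : p (n + 3) = p 4 := hsymm _ _ (by omega)
  have d2 : (n + 6).choose (n + 4) = (n + 6).choose 2 := Nat.choose_symm_of_eq_add (by omega)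
  have d3 : (n + 6).choose (n + 3) = (n + 6).choose 3 := Nat.choose_symm_of_eq_add (by omega)
  have d4 : (n + 6).choose (n + 2) = (n + 6).choose 4 := Nat.choose_symm_of_eq_add (by omega)
  have r1 := hrec 0 (by omega)
  have r2 := hrec 1 (by omega)
  have r3 := hrec 2 (by omega)
  have r4 := hrec (n + 3) (by omega)
  have r5 := hrec (n + 2) (by omega)
  simp only [Nat.reduceSubDiff, Nat.reduceAdd, zero_add, add_assoc, s2, s3,
    s4, s5, d2, d3, d4, Nat.choose_one_right, Nat.choose_zero_right] at r1 r2 r3 r4 r5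
  push_cast at r1 r2 r3 r4 r5 c2
  obtain ⟨hc, hd⟩ := leading_coeffs_eq_zero n (a - 1) (n + 8) (p 1) (p 2) (p 3) (p 4) rfl
    (by linear_combination r1)
    (by linear_combination r2 - 2 * p 1 * (a - 1) * c2)
    (by linear_combination r3 + 2 * p 1 * (c2 - (a - 1) * (c3 + (n + 4) * c2) / 3))
    (by linear_combination r4 + 2 * p 1 * ((c3 + (n + 4) * c2) / 3 - (a - 1) * c2))
    (by linear_combination r5 + 2 * p 1 * (c4 / 4 + (n + 3) * (c3 + (n + 4) * c2) / 12
      - (a - 1) * (c3 + (n + 4) * c2) / 3))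
  have hzero : ∀ k i, i + k = n + 8 → p i = 0 := by
    intro k
    induction k with
    | zero =>
      rintro i rfl
      exact hpm0
    | succ k ih =>
      intro i hi
      match i, k, hi with
      | 0, _, _ => exact hp0
      | i, 0, hi => rw [show i = n + 7 by omega, hsymm (n + 7) 0 (by omega), hp0]
      | i, 1, hi => rw [show i = n + 6 by omega, s2, hc]
      | i, 2, hi => rw [show i = n + 5 by omega, s3, hd]
      | j + 1, k + 3, hi =>
        have h := hrec j (by omega)
        have hcast : (n : ℂ) + 8 = j + k + 5 := by exact_mod_cast (by omega : n + 8 = j + k + 5)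
        rw [ih (j + 2) (by omega), Nat.add_sub_assoc (by omega) n, s2, hc] at h
        push_cast at h
        rw [hcast] at h
        have hk : ((k : ℂ) + 4) * (k + 1) ≠ 0 := by
          exact_mod_cast Nat.mul_ne_zero (Nat.succ_ne_zero (k + 3)) (Nat.succ_ne_zero k)
        refine (mul_eq_zero.mp (?_ : ((k : ℂ) + 4) * (k + 1) * p (j + 1) = 0)).resolve_left hk
        linear_combination h
  refine MvPolynomial.funext fun x => ?_
  have hx : ev2 P (x 0) (x 1) = 0 := by
    rw [hS]
    refine Finset.sum_eq_zero fun i hi => ?_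
    rw [Finset.mem_range] at hi
    rw [hzero (n + 8 - i) i (by omega), zero_mul, zero_mul]
  rw [map_zero, ← hx, ev2]
  congr
  ext i
  fin_cases i <;> rfl
end

section
/- Let a, b ∈ ℂ with a ≠ 1 and a ≠ b, and let P ∈ ℂ[x,y] be a homogeneous polynomial of degree 3 satisfying equation (E) and such that P(λ, 0) = 0 for all λ ∈ ℂ. Then there exists c ∈ ℂ such that P(λ₁, λ₂) = c·λ₁²·λ₂; moreover, if a − b ≠ 2 then P = 0. -/
open MvPolynomial

/-- The value of a homogeneous bivariate polynomial of degree `n` in terms of its coefficients. -/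
theorem ev2_eq_sum_antidiagonal {P : MvPolynomial (Fin 2) ℂ} {n : ℕ} (hP : P.IsHomogeneous n)
    (x y : ℂ) :
    ev2 P x y = ∑ ij ∈ Finset.HasAntidiagonal.antidiagonal n,
      P.coeff (Finsupp.single 0 ij.1 + Finsupp.single 1 ij.2) * (x ^ ij.1 * y ^ ij.2) := by
  have inj : Function.Injective
      (fun ij : ℕ × ℕ => (Finsupp.single 0 ij.1 + Finsupp.single 1 ij.2 : Fin 2 →₀ ℕ)) := by
    rintro ⟨i, j⟩ ⟨k, l⟩ h
    have h0 := DFunLike.congr_fun h 0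
    have h1 := DFunLike.congr_fun h 1
    simp at h0 h1
    simp [h0, h1]
  have hsub : P.support ⊆ (Finset.HasAntidiagonal.antidiagonal n).image
      (fun ij : ℕ × ℕ => (Finsupp.single 0 ij.1 + Finsupp.single 1 ij.2 : Fin 2 →₀ ℕ)) := by
    intro d hd
    have hdeg := hP (mem_support_iff.mp hd)
    rw [Finsupp.weight_apply, Finsupp.sum_fintype _ _ (by simp)] at hdeg
    refine Finset.mem_image.mpr ⟨(d 0, d 1), ?_, ?_⟩
    · simpa [Fin.sum_univ_two] using hdeg
    · ext i
      fin_cases i <;> simp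
  rw [ev2, eval_eq', Finset.sum_subset hsub, Finset.sum_image inj.injOn]
  · simp [Fin.prod_univ_two]
  · intro d _ hd
    rw [notMem_support_iff.mp hd, zero_mul]

theorem stmt5 (a b : ℂ) (ha : a ≠ 1) (hab : a ≠ b)
    (P : MvPolynomial (Fin 2) ℂ) (hhom : P.IsHomogeneous 3)
    (hE : ∀ l1 l2 l3 : ℂ,
      ((b - 1) * l1 - l2 - l3) * ev2 P l2 l3
        - (-l1 + (b - 1) * l2 - l3) * ev2 P l1 l3
        - (l1 - l2) * ev2 P (l1 + l2) l3
        - ((a - 1) * l1 - l3) * ev2 P l2 (l1 + l3)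
        + ((a - 1) * l2 - l3) * ev2 P l1 (l2 + l3) = 0)
    (hP0 : ∀ lam : ℂ, ev2 P lam 0 = 0) :
    (∃ c : ℂ, ∀ l1 l2 : ℂ, ev2 P l1 l2 = c * l1 ^ 2 * l2) ∧
      (a - b ≠ 2 → P = 0) := by
  obtain ⟨s, p, q, r, hf⟩ : ∃ s p q r : ℂ, ∀ x y : ℂ,
      ev2 P x y = s * x ^ 3 + p * x ^ 2 * y + q * x * y ^ 2 + r * y ^ 3 := by
    refine ⟨P.coeff (Finsupp.single 0 3 + Finsupp.single 1 0),
      P.coeff (Finsupp.single 0 2 + Finsupp.single 1 1),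
      P.coeff (Finsupp.single 0 1 + Finsupp.single 1 2),
      P.coeff (Finsupp.single 0 0 + Finsupp.single 1 3), fun x y => ?_⟩
    rw [ev2_eq_sum_antidiagonal hhom, Finset.Nat.sum_antidiagonal_eq_sum_range_succ_mk]
    simp only [Finset.sum_range_succ, Finset.sum_range_zero, Nat.reduceSub, Nat.sub_zero]
    ring
  have ha' : a - 1 ≠ 0 := sub_ne_zero.mpr ha
  simp only [hf] at hE hP0
  obtain rfl : s = 0 := by simpa using hP0 1
  obtain rfl : r = 0 := by
    have h := hE 1 0 0
    exact (mul_eq_zero.mp (by linear_combination -h : (a - 1) * r = 0)).resolve_left ha'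
  obtain rfl : q = 0 := by
    have h := hE 2 1 0
    exact (mul_eq_zero.mp (by linear_combination -h / 6 : (a - 1) * q = 0)).resolve_left ha'
  refine ⟨⟨p, fun x y => by rw [hf]; ring⟩, fun h2 => ?_⟩
  obtain rfl : p = 0 := by
    have h := hE 2 1 1
    exact (mul_eq_zero.mp (by linear_combination h / 2 : (a - b - 2) * p = 0)).resolve_left
      (sub_ne_zero.mpr h2)
  refine MvPolynomial.funext fun v => ?_
  have hv : v = ![v 0, v 1] := by
    ext i
    fin_cases i <;> rfl
  have h := hf (v 0) (v 1)
  rw [ev2, ← hv] at h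
  simpa using h
end

section
/- Let a, b ∈ ℂ with a ≠ 1 and a − b = 5, and let P ∈ ℂ[x,y] be a nonzero homogeneous polynomial of degree 6 satisfying equation (E) and such that P(λ, 0) = 0 for all λ ∈ ℂ. Then (a, b) = (5, 0) and there exists c ∈ ℂ, c ≠ 0, such that P(λ₁, λ₂) = c·λ₁²·λ₂·(λ₁³ + λ₂³ + (20/7)·λ₁·λ₂·(λ₁ + λ₂)). -/
open MvPolynomial

/-- A homogeneous bivariate polynomial of degree `n` evaluates at `(x, y)` to
`∑ i ≤ n, pᵢ xⁱ yⁿ⁻ⁱ`, with `pᵢ` its coefficients. -/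
theorem ev2_eq_sum_of_isHomogeneous {P : MvPolynomial (Fin 2) ℂ} {n : ℕ}
    (hP : P.IsHomogeneous n) (x y : ℂ) :
    ev2 P x y = ∑ i ∈ Finset.range (n + 1),
      P.coeff (Finsupp.equivFunOnFinite.symm ![i, n - i]) * x ^ i * y ^ (n - i) := by
  have hinj : Set.InjOn (fun i : ℕ => Finsupp.equivFunOnFinite.symm ![i, n - i])
      (Finset.range (n + 1)) := by
    intro i _ j _ hij
    simpa using DFunLike.congr_fun hij 0
  have hsub : P.support ⊆ (Finset.range (n + 1)).image
      (fun i : ℕ => Finsupp.equivFunOnFinite.symm ![i, n - i]) := by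
    intro d hd
    have hdeg : d 0 + d 1 = n := by
      have h := hP (mem_support_iff.mp hd)
      rwa [Pi.one_def, ← Finsupp.degree_eq_weight_one, Finsupp.degree_eq_sum, Fin.sum_univ_two] at h
    refine Finset.mem_image.mpr ⟨d 0, Finset.mem_range.mpr (by lia), ?_⟩
    ext k
    fin_cases k
    · simp
    · simp
      lia
  rw [ev2, eval_eq', Finset.sum_subset hsub, Finset.sum_image hinj]
  · simp [Fin.prod_univ_two, mul_assoc]
  · intro d _ hd
    rw [notMem_support_iff.mp hd, zero_mul]

/-- A bivariate polynomial whose values all vanish is zero. -/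
theorem eq_zero_of_ev2_eq_zero {P : MvPolynomial (Fin 2) ℂ} (h : ∀ x y, ev2 P x y = 0) :
    P = 0 := by
  refine MvPolynomial.funext fun v => ?_
  have hv : v = ![v 0, v 1] := by
    ext k
    fin_cases k <;> rfl
  rw [hv, map_zero]
  exact h (v 0) (v 1)

theorem stmt6 (a b : ℂ) (ha : a ≠ 1) (hab : a - b = 5)
    (P : MvPolynomial (Fin 2) ℂ) (hP : P ≠ 0) (hhom : P.IsHomogeneous 6)
    (hE : ∀ l1 l2 l3 : ℂ,
      ((b - 1) * l1 - l2 - l3) * ev2 P l2 l3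
        - (-l1 + (b - 1) * l2 - l3) * ev2 P l1 l3
        - (l1 - l2) * ev2 P (l1 + l2) l3
        - ((a - 1) * l1 - l3) * ev2 P l2 (l1 + l3)
        + ((a - 1) * l2 - l3) * ev2 P l1 (l2 + l3) = 0)
    (hP0 : ∀ lam : ℂ, ev2 P lam 0 = 0) :
    a = 5 ∧ b = 0 ∧ ∃ c : ℂ, c ≠ 0 ∧ ∀ l1 l2 : ℂ,
      ev2 P l1 l2 = c * l1 ^ 2 * l2 *
        (l1 ^ 3 + l2 ^ 3 + (20 / 7) * l1 * l2 * (l1 + l2)) := by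
  obtain ⟨p, hp⟩ : ∃ p : ℕ → ℂ, ∀ x y : ℂ, ev2 P x y = p 0 * y ^ 6 + p 1 * x * y ^ 5
      + p 2 * x ^ 2 * y ^ 4 + p 3 * x ^ 3 * y ^ 3 + p 4 * x ^ 4 * y ^ 2 + p 5 * x ^ 5 * y
      + p 6 * x ^ 6 := by
    refine ⟨fun i => P.coeff (Finsupp.equivFunOnFinite.symm ![i, 6 - i]), fun x y => ?_⟩
    rw [ev2_eq_sum_of_isHomogeneous hhom]
    simp [Finset.sum_range_succ]
  obtain rfl : b = a - 5 := by linear_combination -hab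
  have ha' : a - 1 ≠ 0 := sub_ne_zero.mpr ha
  simp only [hp] at hE hP0
  have h6 : p 6 = 0 := by linear_combination hP0 1
  have h0 : p 0 = 0 := by
    refine (mul_eq_zero.mp ?_).resolve_left ha'
    linear_combination -hE 1 0 0
  simp only [h6, h0] at hE
  have h1 : p 1 = 0 := by
    refine (mul_eq_zero.mp ?_).resolve_left ha'
    linear_combination (-1 / 40) * ((-1 / 6 * hE 1 3 0 + 9 / 2 * hE 1 (-1) 0)
      - 8 / 3 * (-1 / 2 * hE 1 2 0 + 2 * hE 1 (-1) 0))
  simp only [h1] at hE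
  have h5 : p 5 = p 2 := by
    refine sub_eq_zero.mp ((mul_eq_zero.mp ?_).resolve_left ha')
    linear_combination (1 / 18) * (-1 / 2 * hE 1 2 0 + 2 * hE 1 (-1) 0)
  simp only [h5] at hE
  have h4 : p 4 = p 3 := by
    refine sub_eq_zero.mp ((mul_eq_zero.mp ?_).resolve_left ha')
    linear_combination -1 / 2 * hE 1 (-1) 0
  simp only [h4] at hE
  have hU : (10 - 6 * a) * p 2 + (3 * a - 8) * p 3 = 0 := by
    linear_combination 1 / 2 * hE 1 (-1) 1
  have hV : -4 * a * p 2 + (2 * a - 3) * p 3 = 0 := by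
    linear_combination -1 / 12 * hE 1 2 1 - 1 / 3 * hU
  have hP23 : ¬(p 2 = 0 ∧ p 3 = 0) := fun ⟨h2, h3⟩ =>
    hP (eq_zero_of_ev2_eq_zero fun x y => by simp [hp, h0, h1, h2, h3, h4, h5, h6])
  have ha5 : a = 5 := by
    by_contra hne
    have hne' : a - 5 ≠ 0 := sub_ne_zero.mpr hne
    refine hP23 ⟨(mul_eq_zero.mp ?_).resolve_left hne', (mul_eq_zero.mp ?_).resolve_left hne'⟩
    · linear_combination 1 / 6 * (2 * a - 3) * hU - 1 / 6 * (3 * a - 8) * hV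
    · linear_combination 1 / 6 * (10 - 6 * a) * hV + 1 / 6 * 4 * a * hU
  subst ha5
  have h3 : p 3 = 20 / 7 * p 2 := by linear_combination 1 / 7 * hU
  refine ⟨rfl, by norm_num, p 2, fun h2 => hP23 ⟨h2, by rw [h3, h2, mul_zero]⟩, fun x y => ?_⟩
  rw [hp, h0, h1, h4, h5, h6, h3]
  ring
end

section
/- Let b ∈ ℂ with b ≠ 0 and b ≠ 1, let m ≥ 7 be an integer, and let P ∈ ℂ[x,y] be a homogeneous polynomial of degree m satisfying equation (E) with parameters (a, b) = (1, b), and such that P(λ, −λ) = 0 for all λ ∈ ℂ. Then P = 0. -/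
open MvPolynomial

/-- A homogeneous bivariate form is evaluated as a finite sum of monomials `x ^ k * y ^ (m - k)`. -/
lemma exists_coeff_of_isHomogeneous {m : ℕ} {P : MvPolynomial (Fin 2) ℂ}
    (hhom : P.IsHomogeneous m) :
    ∃ c : ℕ → ℂ, (∀ k, m < k → c k = 0) ∧
      ∀ x y, ev2 P x y = ∑ k ∈ Finset.range (m + 1), c k * (x ^ k * y ^ (m - k)) := by
  have hdeg : ∀ d ∈ P.support, d 0 + d 1 = m := by
    intro d hd
    have h := hhom (MvPolynomial.mem_support_iff.mp hd)
    rw [Finsupp.weight_apply, Finsupp.sum_fintype _ _ (by simp)] at h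
    simpa using h
  refine ⟨fun k => ∑ d ∈ P.support with d 0 = k, P.coeff d, ?_, ?_⟩
  · intro k hk
    apply Finset.sum_eq_zero
    intro d hd
    rw [Finset.mem_filter] at hd
    have := hdeg d hd.1
    omega
  · intro x y
    rw [ev2, MvPolynomial.eval_eq']
    rw [← Finset.sum_fiberwise_of_maps_to (t := Finset.range (m + 1)) (g := fun d => d 0)]
    · refine Finset.sum_congr rfl fun k _ => ?_
      rw [Finset.sum_mul]
      refine Finset.sum_congr rfl fun d hd => ?_
      rw [Finset.mem_filter] at hd
      have h1 := hdeg d hd.1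
      have h2 : d 1 = m - k := by omega
      simp [Fin.prod_univ_two, hd.2, h2]
    · intro d hd
      have := hdeg d hd
      simp only [Finset.mem_range]
      omega

/-- A polynomial in two variables over `ℂ` which vanishes as a function has zero coefficients. -/
lemma coeff_coeff_eq_zero_of_eval_eval (G : Polynomial (Polynomial ℂ))
    (hG : ∀ x y : ℂ, (G.eval (Polynomial.C y)).eval x = 0) (i j : ℕ) :
    (G.coeff j).coeff i = 0 := by
  have hmap : ∀ x : ℂ, G.map (Polynomial.evalRingHom x) = 0 := by
    intro x
    apply Polynomial.funext
    intro y
    have h := hG x y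
    rw [← Polynomial.coe_evalRingHom, ← Polynomial.eval₂_at_apply] at h
    rw [Polynomial.eval_map]
    simpa using h
  have hj : G.coeff j = 0 := by
    apply Polynomial.funext
    intro x
    simpa using congrArg (fun q => q.coeff j) (hmap x)
  simp [hj]

/-- The cocycle condition compared coefficientwise at `x ^ (i + 1) * y ^ (j + 1)`. -/
lemma coeff_relation {b : ℂ} {m : ℕ} {c : ℕ → ℂ} (hc : ∀ k, m < k → c k = 0)
    (h : ∀ x y : ℂ, ∑ k ∈ Finset.range (m + 1), c k *
      (((b - 1) * x - y - 1) * y ^ k - (-x + (b - 1) * y - 1) * x ^ k - (x - y) * (x + y) ^ k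
        + y ^ k * (x + 1) ^ (m - k) - x ^ k * (y + 1) ^ (m - k)) = 0) (i j : ℕ) :
    (if i = 0 then (b - 1) * c (j + 1) else 0) - (if j = 0 then (b - 1) * c (i + 1) else 0)
      - ((i + j + 1).choose (j + 1) : ℂ) * c (i + j + 1)
      + ((i + j + 1).choose j : ℂ) * c (i + j + 1)
      + ((m - (j + 1)).choose (i + 1) : ℂ) * c (j + 1)
      - ((m - (i + 1)).choose (j + 1) : ℂ) * c (i + 1) = 0 := by
  set x : Polynomial (Polynomial ℂ) := Polynomial.C Polynomial.X with hx
  set y : Polynomial (Polynomial ℂ) := Polynomial.X with hy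
  set β : Polynomial (Polynomial ℂ) := Polynomial.C (Polynomial.C (b - 1)) with hβ
  have key := coeff_coeff_eq_zero_of_eval_eval
    (∑ k ∈ Finset.range (m + 1), Polynomial.C (Polynomial.C (c k)) *
      ((β * x - y - 1) * y ^ k - (-x + β * y - 1) * x ^ k - (x - y) * (y + x) ^ k
        + y ^ k * (x + 1) ^ (m - k) - x ^ k * (y + 1) ^ (m - k)))
    (by
      intro u v
      rw [← h u v]
      simp [hx, hy, hβ, Polynomial.eval_finsetSum, add_comm]) (i + 1) (j + 1)
  have pick : ∀ (l : ℕ) (a : ℂ),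
      ∑ k ∈ Finset.range (m + 1), c k * (if k = l then a else 0) = a * c l := by
    intro l a
    simp only [mul_ite, mul_zero, Finset.sum_ite_eq', Finset.mem_range]
    split_ifs with hl
    · ring
    · rw [hc l (by omega), mul_zero]
  have term : ∀ k, (((β * x - y - 1) * y ^ k - (-x + β * y - 1) * x ^ k - (x - y) * (y + x) ^ k
        + y ^ k * (x + 1) ^ (m - k) - x ^ k * (y + 1) ^ (m - k)).coeff (j + 1)).coeff (i + 1)
      = (if k = j + 1 then (if i = 0 then b - 1 else 0) else 0)
        - (if k = i + 1 then (if j = 0 then b - 1 else 0) else 0)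
        - (if k = i + j + 1 then ((i + j + 1).choose (j + 1) : ℂ) else 0)
        + (if k = i + j + 1 then ((i + j + 1).choose j : ℂ) else 0)
        + (if k = j + 1 then ((m - (j + 1)).choose (i + 1) : ℂ) else 0)
        - (if k = i + 1 then ((m - (i + 1)).choose (j + 1) : ℂ) else 0) := by
    intro k
    have expand : (β * x - y - 1) * y ^ k - (-x + β * y - 1) * x ^ k - (x - y) * (y + x) ^ k
        + y ^ k * (x + 1) ^ (m - k) - x ^ k * (y + 1) ^ (m - k)
        = Polynomial.C (Polynomial.C (b - 1) * Polynomial.X) * y ^ k - y ^ (k + 1) - y ^ k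
          + Polynomial.C (Polynomial.X ^ (k + 1) + Polynomial.X ^ k)
          - Polynomial.C (Polynomial.C (b - 1) * Polynomial.X ^ k) * y
          - Polynomial.C Polynomial.X * (y + Polynomial.C Polynomial.X) ^ k
          + y * (y + Polynomial.C Polynomial.X) ^ k
          + Polynomial.C ((Polynomial.X + 1) ^ (m - k)) * y ^ k
          - Polynomial.C (Polynomial.X ^ k) * (y + 1) ^ (m - k) := by
      simp only [hx, hβ, map_mul, map_pow, map_add, map_one]
      ring
    rw [expand, hy]
    simp only [Polynomial.coeff_sub, Polynomial.coeff_add, Polynomial.coeff_C_mul,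
      Polynomial.coeff_X_pow, Polynomial.coeff_C_succ, Polynomial.coeff_X_add_C_pow,
      Polynomial.coeff_X_mul, Polynomial.coeff_X_add_one_pow, Polynomial.coeff_X,
      Polynomial.coeff_mul_natCast, mul_ite, mul_one, mul_zero]
    have ite_coeff : ∀ (p : Prop) [Decidable p] (q : Polynomial ℂ),
        (if p then q else 0).coeff (i + 1) = if p then q.coeff (i + 1) else 0 := by
      intro p _ q
      split_ifs <;> simp
    have choose_x : (if i = k - (j + 1) then (1 : ℂ) else 0) * (k.choose (j + 1) : ℂ)
        = if k = i + j + 1 then ((i + j + 1).choose (j + 1) : ℂ) else 0 := by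
      rcases lt_or_ge k (j + 1) with hk | hk
      · rw [Nat.choose_eq_zero_of_lt hk, if_neg (by omega : k ≠ i + j + 1)]
        simp
      · by_cases hi : k = i + j + 1
        · subst hi
          rw [if_pos (by omega), if_pos rfl, one_mul]
        · rw [if_neg hi, if_neg (by omega), zero_mul]
    have choose_y : (if i + 1 = k - j then (1 : ℂ) else 0) * (k.choose j : ℂ)
        = if k = i + j + 1 then ((i + j + 1).choose j : ℂ) else 0 := by
      by_cases hi : k = i + j + 1
      · subst hi
        rw [if_pos (by omega), if_pos rfl, one_mul]
      · rw [if_neg hi, if_neg (by omega), zero_mul]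
    have choose_z : (if i + 1 = k then (1 : ℂ) else 0) * ((m - k).choose (j + 1) : ℂ)
        = if k = i + 1 then ((m - (i + 1)).choose (j + 1) : ℂ) else 0 := by
      by_cases hi : k = i + 1
      · simp [hi]
      · rw [if_neg hi, if_neg (Ne.symm hi), zero_mul]
    rw [choose_x, choose_y, choose_z]
    simp only [ite_coeff, Polynomial.coeff_C_mul, Polynomial.coeff_X_add_one_pow,
      Polynomial.coeff_X_pow, Polynomial.coeff_X, Polynomial.coeff_one, Polynomial.coeff_zero]
    have e1 : j + 1 = k ↔ k = j + 1 := eq_comm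
    have e2 : i + 1 = k ↔ k = i + 1 := eq_comm
    have e3 : 1 = i + 1 ↔ i = 0 := by omega
    have e4 : 1 = j + 1 ↔ j = 0 := by omega
    simp only [e1, e2, e3, e4]
    congr 2
    · congr 2
      by_cases hj : k = j + 1 <;> by_cases hi : k = i + 1 <;> by_cases h0 : j = 0 <;>
        by_cases h1 : i = 0 <;> simp [hj, hi, h0, h1]
    · by_cases hj : k = j + 1
      · simp [hj]
      · rw [if_neg hj, if_neg hj]
  simp only [Polynomial.finsetSum_coeff, Polynomial.coeff_C_mul, term] at key
  simp only [mul_sub, mul_add, Finset.sum_sub_distrib, Finset.sum_add_distrib, pick] at key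
  simpa only [ite_mul, zero_mul] using key

/-- The binomial coefficients `choose (m - 1) k` solve the recursion at `x ^ 2 * y ^ k`. -/
lemma choose_recursion {m k : ℕ} (hk : k + 1 ≤ m) :
    (((k + 1).choose 2 : ℂ) - (k + 1)) * ((m - 1).choose (k + 1) : ℂ)
      + ((m - k).choose 2 : ℂ) * ((m - 1).choose k : ℂ)
      = ((m - 2).choose k : ℂ) * ((m - 1).choose 2 : ℂ) := by
  obtain ⟨r, rfl⟩ := Nat.exists_eq_add_of_le hk
  rw [show k + 1 + r - 1 = k + r by omega, show k + 1 + r - k = r + 1 by omega,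
    show k + 1 + r - 2 = k + r - 1 by omega]
  have h1 : ((k + r).choose (k + 1) : ℂ) * (k + 1) = (k + r).choose k * r := by
    have h := Nat.choose_succ_right_eq (k + r) k
    rw [Nat.add_sub_cancel_left] at h
    exact_mod_cast h
  have h2 : ((k + r : ℕ) : ℂ) * ((k + r - 1).choose k : ℂ) = (k + r).choose k * r := by
    rcases Nat.eq_zero_or_pos (k + r) with h0 | h0
    · obtain ⟨rfl, rfl⟩ : k = 0 ∧ r = 0 := by omega
      simp
    · have h := Nat.choose_mul_succ_eq (k + r - 1) k
      rw [Nat.sub_add_cancel h0, Nat.add_sub_cancel_left] at h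
      rw [mul_comm]
      exact_mod_cast h
  simp only [Nat.cast_choose_two]
  push_cast at h2 ⊢
  linear_combination ((k : ℂ) - 2) / 2 * h1 - ((k : ℂ) + r - 1) / 2 * h2

/-- Solutions of the recursions at `x ^ 2 * y ^ k` and `x ^ 3 * y ^ 4` are multiples of the
binomial coefficients `choose (m - 1) k`. -/
lemma coeff_eq_smul_choose {m : ℕ} (hm : 7 ≤ m) {c : ℕ → ℂ} (hc : ∀ k, m < k → c k = 0)
    (hrec : ∀ k, 3 ≤ k → (((k + 1).choose 2 : ℂ) - (k + 1)) * c (k + 1)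
      + ((m - k).choose 2 : ℂ) * c k = ((m - 2).choose k : ℂ) * c 2)
    (hcubic : 5 * c 6 + ((m - 4).choose 3 : ℂ) * c 4 - ((m - 3).choose 4 : ℂ) * c 3 = 0) :
    ∃ t : ℂ, ∀ k, 2 ≤ k → c k = t * ((m - 1).choose k : ℂ) := by
  have hne : ((m - 1).choose 2 : ℂ) ≠ 0 := by
    exact_mod_cast (Nat.choose_pos (by omega : 2 ≤ m - 1)).ne'
  obtain ⟨t, ht⟩ : ∃ t : ℂ, c 2 = t * ((m - 1).choose 2 : ℂ) := ⟨c 2 / ((m - 1).choose 2 : ℂ), by field_simp⟩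
  have hthree : c 3 = t * ((m - 1).choose 3 : ℂ) := by
    obtain ⟨n, rfl⟩ := Nat.exists_eq_add_of_le' hm
    have h3 := hrec 3 le_rfl
    have h4 := hrec 4 (by norm_num)
    have h5 := hrec 5 (by norm_num)
    rw [ht] at h3 h4 h5
    simp only [show n + 7 - 1 = n + 6 by omega, show n + 7 - 2 = n + 5 by omega,
      show n + 7 - 3 = n + 4 by omega, show n + 7 - 4 = n + 3 by omega,
      show n + 7 - 5 = n + 2 by omega] at h3 h4 h5 hcubic ⊢
    have hchoose : ∀ N r : ℕ, (N.choose r : ℂ) = (N.descFactorial r : ℂ) / (r.factorial : ℂ) := by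
      intro N r
      rw [Nat.descFactorial_eq_factorial_mul_choose, Nat.cast_mul,
        mul_div_cancel_left₀ _ (by exact_mod_cast r.factorial_ne_zero)]
    simp only [hchoose] at h3 h4 h5 hcubic ⊢
    norm_num [Nat.descFactorial, Nat.factorial] at h3 h4 h5 hcubic ⊢
    have hpos : ((n : ℂ) + 1) * (n + 2) * (n + 3) * (n + 4) * (n + 5) * (n + 6) ≠ 0 := by
      exact_mod_cast (by positivity :
        (n + 1) * (n + 2) * (n + 3) * (n + 4) * (n + 5) * (n + 6) ≠ 0)
    apply mul_left_cancel₀ hpos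
    linear_combination -144 * (hcubic - 5 / 9 * h5 + (n + 2 : ℂ) * (n + 1) / 18 * h4
      - (n + 3) * (n + 2) * (n + 1) * (n + 8) / 72 * h3)
  refine ⟨t, fun k hk => ?_⟩
  obtain rfl | hk3 : k = 2 ∨ 3 ≤ k := by omega
  · exact ht
  induction k, hk3 using Nat.le_induction with
  | base => exact hthree
  | succ k hk3 ih =>
    rcases lt_or_ge m (k + 1) with hkm | hkm
    · rw [hc _ hkm, Nat.choose_eq_zero_of_lt (by omega)]
      simp
    · have h1 := hrec k hk3
      have h2 := choose_recursion hkm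
      rw [ht, ih (by omega)] at h1
      have hcoef : ((k + 1).choose 2 : ℂ) - (k + 1) ≠ 0 := by
        rw [Nat.cast_choose_two]
        push_cast
        have e : ((k : ℂ) + 1) * (k + 1 - 1) / 2 - (k + 1) = (k + 1) * (k - 2) / 2 := by ring
        rw [e]
        have a1 : (k : ℂ) + 1 ≠ 0 := by exact_mod_cast k.succ_ne_zero
        have a2 : (k : ℂ) - 2 ≠ 0 := by
          rw [sub_ne_zero]
          exact_mod_cast (by omega : k ≠ 2)
        exact div_ne_zero (mul_ne_zero a1 a2) two_ne_zero
      apply mul_left_cancel₀ hcoef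
      linear_combination h1 - t * h2

theorem stmt9 (b : ℂ) (hb0 : b ≠ 0) (hb1 : b ≠ 1) (m : ℕ) (hm : 7 ≤ m)
    (P : MvPolynomial (Fin 2) ℂ) (hhom : P.IsHomogeneous m)
    (hE : ∀ l1 l2 l3 : ℂ,
      ((b - 1) * l1 - l2 - l3) * ev2 P l2 l3
        - (-l1 + (b - 1) * l2 - l3) * ev2 P l1 l3
        - (l1 - l2) * ev2 P (l1 + l2) l3
        - (((1 : ℂ) - 1) * l1 - l3) * ev2 P l2 (l1 + l3)
        + (((1 : ℂ) - 1) * l2 - l3) * ev2 P l1 (l2 + l3) = 0)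
    (hPd : ∀ lam : ℂ, ev2 P lam (-lam) = 0) :
    P = 0 := by
  obtain ⟨c, hc, hev⟩ := exists_coeff_of_isHomogeneous hhom
  have hzero : c 0 = 0 := by
    have h := hE 0 (-1) 1
    have h01 : ev2 P 0 1 = c 0 := by
      rw [hev, Finset.sum_eq_single 0] <;> simp +contextual
    have h00 : ev2 P 0 0 = 0 := by
      simpa using hPd 0
    simp only [zero_add, neg_add_cancel, h00, h01] at h
    have h' : b * c 0 = 0 := by linear_combination h
    exact (mul_eq_zero.mp h').resolve_left hb0
  have hrel := coeff_relation (b := b) (m := m) hc (by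
    intro x y
    have h := hE x y 1
    simp only [hev, one_pow, mul_one] at h
    rw [← h]
    simp only [Finset.mul_sum, ← Finset.sum_sub_distrib, ← Finset.sum_add_distrib]
    refine Finset.sum_congr rfl fun k _ => ?_
    ring)
  have hlin : ∀ k, 2 ≤ k → (b + m - 2) * c k = ((m - 1).choose k : ℂ) * c 1 := by
    intro k hk
    rcases lt_or_ge m k with hkm | hkm
    · rw [hc k hkm, Nat.choose_eq_zero_of_lt (by omega)]
      simp
    · obtain ⟨j, rfl⟩ := Nat.exists_eq_add_of_le' (by omega : 1 ≤ k)
      have h := hrel 0 j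
      rw [if_pos rfl, if_neg (by omega)] at h
      simp only [zero_add, Nat.choose_self, Nat.choose_succ_self_right, Nat.choose_one_right,
        Nat.cast_sub hkm] at h
      push_cast at h
      linear_combination h
  obtain ⟨t, ht, ht1⟩ : ∃ t : ℂ, (∀ k, 2 ≤ k → c k = t * ((m - 1).choose k : ℂ)) ∧
      c 1 = t * (b + m - 2) := by
    by_cases hcrit : b + m - 2 = 0
    · have hone : c 1 = 0 := by
        have h := hlin 2 le_rfl
        rw [hcrit, zero_mul] at h
        have hne : ((m - 1).choose 2 : ℂ) ≠ 0 := by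
          exact_mod_cast (Nat.choose_pos (by omega : 2 ≤ m - 1)).ne'
        exact (mul_eq_zero.mp h.symm).resolve_left hne
      obtain ⟨t, ht⟩ := coeff_eq_smul_choose hm hc (by
        intro k hk
        obtain ⟨j, rfl⟩ := Nat.exists_eq_add_of_le' (by omega : 1 ≤ k)
        have h := hrel 1 j
        rw [if_neg one_ne_zero, if_neg (by omega)] at h
        rw [show 1 + j + 1 = j + 1 + 1 by omega, Nat.choose_succ_self_right,
          Nat.choose_symm_of_eq_add (show j + 1 + 1 = j + 2 by omega)] at h
        push_cast at h ⊢
        linear_combination h) (by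
        have h := hrel 2 3
        norm_num [Nat.choose] at h
        linear_combination h)
      exact ⟨t, ht, by rw [hone, hcrit, mul_zero]⟩
    · refine ⟨c 1 / (b + m - 2), fun k hk => ?_, by field_simp⟩
      have h := hlin k hk
      field_simp
      linear_combination h
  have htzero : t = 0 := by
    have h := hPd (-1)
    have hterm : ∀ k, c k = t * ((m - 1).choose k : ℂ) + (if k = 0 then -t else 0)
        + (if k = 1 then t * (b - 1) else 0) := by
      intro k
      match k with
      | 0 => simp [hzero]
      | 1 =>
        rw [ht1, Nat.choose_one_right, Nat.cast_sub (by omega)]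
        simp
        ring
      | k + 2 => simp [ht]
    have hbinom : ∑ k ∈ Finset.range (m + 1), ((m - 1).choose k : ℂ) * (-1) ^ k = 0 := by
      have h' := add_pow (-1 : ℂ) 1 (m - 1)
      rw [neg_add_cancel, zero_pow (by omega), Nat.sub_add_cancel (by omega)] at h'
      rw [Finset.sum_range_succ, Nat.choose_eq_zero_of_lt (by omega), h']
      simp [mul_comm]
    rw [hev] at h
    simp only [neg_neg, one_pow, mul_one, hterm, add_mul, Finset.sum_add_distrib, mul_assoc,
      ← Finset.mul_sum, hbinom, ite_mul, zero_mul, Finset.sum_ite_eq', Finset.mem_range] at h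
    rw [if_pos (by omega), if_pos (by omega)] at h
    have h' : t * b = 0 := by linear_combination -h
    exact (mul_eq_zero.mp h').resolve_right hb0
  have hall : ∀ k, c k = 0 := by
    intro k
    match k with
    | 0 => exact hzero
    | 1 => rw [ht1, htzero, zero_mul]
    | k + 2 => rw [ht _ (by omega), htzero, zero_mul]
  apply MvPolynomial.funext
  intro v
  have hv : v = ![v 0, v 1] := by
    ext i
    fin_cases i <;> rfl
  have h := hev (v 0) (v 1)
  simp only [hall, zero_mul, Finset.sum_const_zero] at h
  rw [ev2, ← hv] at h
  rw [h, map_zero]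
end

section
/- Let a₀ ∈ ℂ and suppose there exist polynomials g₂, g₃ ∈ ℂ[x,y] such that for all λ, μ, ∂ ∈ ℂ the following two identities hold: (3μ + λ + ∂)·g₃(λ,∂) + (2λ + ∂)·g₃(μ, λ+∂) − (λ − μ)·g₃(λ+μ, ∂) = (3λ + μ + ∂)·g₃(μ,∂) + (2μ + ∂)·g₃(λ, ∂+μ) + 2a₀(λ+μ)(λ−μ), and 2μ·a₀·(∂ + 2λ) + (λ + ∂)·g₂(μ, λ+∂) + μ·g₂(λ+μ, ∂) = (3λ + μ + ∂)·g₂(μ, ∂) + μ·g₃(λ, μ+∂). Then a₀ = 0. -/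
open MvPolynomial

theorem stmt10 (a₀ : ℂ)
    (h : ∃ g₂ g₃ : MvPolynomial (Fin 2) ℂ,
      (∀ lam mu d : ℂ,
        (3 * mu + lam + d) * ev2 g₃ lam d + (2 * lam + d) * ev2 g₃ mu (lam + d)
          - (lam - mu) * ev2 g₃ (lam + mu) d
        = (3 * lam + mu + d) * ev2 g₃ mu d + (2 * mu + d) * ev2 g₃ lam (d + mu)
          + 2 * a₀ * (lam + mu) * (lam - mu)) ∧
      (∀ lam mu d : ℂ,
        2 * mu * a₀ * (d + 2 * lam) + (lam + d) * ev2 g₂ mu (lam + d)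
          + mu * ev2 g₂ (lam + mu) d
        = (3 * lam + mu + d) * ev2 g₂ mu d + mu * ev2 g₃ lam (mu + d))) :
    a₀ = 0 := by
  obtain ⟨g₂, g₃, -, h₂⟩ := h
  -- At `lam = 0` the `g₂` terms cancel, leaving `2 * mu * a₀ * d = mu * g₃(0, mu + d)`.
  have h₁₀ := h₂ 0 1 0
  have h₂₁ := h₂ 0 2 (-1)
  norm_num at h₁₀ h₂₁
  linear_combination (-1 / 2) * h₁₀ - (1 / 4) * h₂₁
end

section
/- Let g ∈ ℂ[x,y] be a polynomial such that for all λ, μ, ∂ ∈ ℂ: (λ + ∂)·g(μ, λ+∂) − (3λ + μ + ∂)·g(μ, ∂) + μ·g(λ+μ, ∂) = 0. Then there exists a₂ ∈ ℂ such that g(λ, ∂) = a₂·λ·(λ − ∂) for all λ, ∂ ∈ ℂ. -/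
open MvPolynomial

/-- The functional equation alone, without any regularity assumption, determines `G` up to
a scalar. -/
theorem eq_mul_mul_sub_of_functional_equation (G : ℂ → ℂ → ℂ)
    (h : ∀ lam mu d : ℂ,
      (lam + d) * G mu (lam + d) - (3 * lam + mu + d) * G mu d + mu * G (lam + mu) d = 0)
    (lam d : ℂ) : G lam d = G 1 0 * lam * (lam - d) := by
  -- Setting `d = 0` expresses `G` through `G · 0`.
  have hG (m l : ℂ) : l * G m l = (3 * l + m) * G m 0 - m * G (l + m) 0 := by
    have := h l m 0
    simp only [add_zero] at this
    linear_combination this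
  have h0 : G 0 0 = 0 := by
    have h1 := h (-1) 0 1
    have h2 := h 1 0 0
    norm_num at h1 h2
    linear_combination (h1 - h2) / 3
  have hf (l m : ℂ) (hm : m ≠ 0) :
      (3 * l + 2 * m) * G m 0 - l * G l 0 + (l - 2 * m) * G (l + m) 0 = 0 := by
    have e := h l m (-m)
    have e1 := hG m (l + -m)
    have e2 := hG m (-m)
    have e3 := hG (l + m) (-m)
    rw [neg_add_cancel_right] at e1
    rw [neg_add_cancel, h0] at e2
    rw [show -m + (l + m) = l by ring] at e3
    refine (mul_eq_zero.mp ?_).resolve_left hm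
    linear_combination -m * e + m * e1 + 3 * l * e2 - m * e3
  have hsq (l : ℂ) : G l 0 = G 1 0 * l ^ 2 := by
    rcases eq_or_ne l 0 with rfl | hl
    · simp [h0]
    · have e1 := hf l 1 one_ne_zero
      have e2 := hf 1 l hl
      rw [add_comm 1 l] at e2
      linear_combination ((1 - 2 * l) * e1 - (l - 2) * e2) / 6
  rcases eq_or_ne d 0 with rfl | hd
  · rw [hsq]; ring
  · refine mul_left_cancel₀ hd ?_
    rw [hG, hsq lam, hsq (d + lam)]
    ring

theorem stmt11 (g : MvPolynomial (Fin 2) ℂ)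
    (h : ∀ lam mu d : ℂ,
      (lam + d) * ev2 g mu (lam + d) - (3 * lam + mu + d) * ev2 g mu d
        + mu * ev2 g (lam + mu) d = 0) :
    ∃ a₂ : ℂ, ∀ lam d : ℂ, ev2 g lam d = a₂ * lam * (lam - d) := by
  exact ⟨ev2 g 1 0, eq_mul_mul_sub_of_functional_equation (ev2 g) h⟩
end

section
/- Let c ∈ ℂ and let h ∈ ℂ[x,y] be a polynomial such that for all λ, μ, ∂ ∈ ℂ the following two identities hold: 3c·μ·λ² + λ·h(μ, λ+∂) = 3c·λ·μ² + μ·h(λ, μ+∂), and (λ + 4μ + ∂)·h(λ, ∂) = λ·h(λ+μ, ∂) + 3c·λ·μ² + (2μ + ∂)·h(λ, μ+∂). Then h(λ, ∂) = c·λ·(λ − 2∂) for all λ, ∂ ∈ ℂ. -/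
open MvPolynomial

theorem stmt12 (c : ℂ) (h : MvPolynomial (Fin 2) ℂ)
    (h1 : ∀ lam mu d : ℂ,
      3 * c * mu * lam ^ 2 + lam * ev2 h mu (lam + d)
        = 3 * c * lam * mu ^ 2 + mu * ev2 h lam (mu + d))
    (h2 : ∀ lam mu d : ℂ,
      (lam + 4 * mu + d) * ev2 h lam d
        = lam * ev2 h (lam + mu) d + 3 * c * lam * mu ^ 2
          + (2 * mu + d) * ev2 h lam (mu + d)) :
    ∀ lam d : ℂ, ev2 h lam d = c * lam * (lam - 2 * d) := by
  -- Subtract the claimed solution; the difference `g` solves the homogeneous identities.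
  obtain ⟨g, hg⟩ : ∃ g : ℂ → ℂ → ℂ, ∀ x y, ev2 h x y = g x y + c * x * (x - 2 * y) :=
    ⟨fun x y => ev2 h x y - c * x * (x - 2 * y), fun x y => by ring⟩
  simp only [hg] at h1 h2
  have g_eq_mul (a b : ℂ) : g a b = a * g 1 (a + b - 1) := by
    have e := h1 1 a (b - 1)
    rw [add_sub_cancel, ← add_sub_assoc] at e
    linear_combination e
  have g_one_step (m d : ℂ) :
      (1 + 4 * m + d) * g 1 d = (1 + 3 * m + d) * g 1 (m + d) := by
    have e := h2 1 m d
    rw [g_eq_mul (1 + m) d, show 1 + m + d - 1 = m + d by ring] at e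
    linear_combination e
  have g_one_neg_one : g 1 (-1) = 0 := by
    have e₁ := g_one_step 1 (-1)
    have e₂ := g_one_step (-1) 0
    norm_num at e₁ e₂
    linear_combination (e₁ + e₂) / 2
  have g_one (x : ℂ) : g 1 x = 0 := by
    by_cases hx : x = -1
    · rw [hx, g_one_neg_one]
    · have e := g_one_step (x + 1) (-1)
      rw [g_one_neg_one, add_neg_cancel_right] at e
      have hx' : x + 1 ≠ 0 := fun hx' => hx (eq_neg_of_add_eq_zero_left hx')
      refine (mul_eq_zero.mp ?_).resolve_left hx'
      linear_combination -e / 3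
  intro lam d
  rw [hg, g_eq_mul, g_one, mul_zero, zero_add]
end

section
/- Let b, c, k ∈ ℂ and let h ∈ ℂ[x,y] be a polynomial such that for all λ, μ, ∂ ∈ ℂ: μ·h(λ+μ, ∂) − (4λ + μ + ∂)·h(μ, ∂) + (λ + ∂)·h(μ, λ+∂) = −3b·λ²·μ·∂ + 3c²·λ²·μ² + k·λ³·μ. Then h(λ, ∂) = (1/2)(k − b − c²)·λ·∂² − (3/2)(k − c² + b)·λ²·∂ + (1/2)(k + b + c²)·λ³ for all λ, ∂ ∈ ℂ. -/
open MvPolynomial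

/-- Restricting a bivariate polynomial to a horizontal line gives a univariate polynomial. -/
theorem exists_polynomial_eval_eq_ev2 (P : MvPolynomial (Fin 2) ℂ) (d : ℂ) :
    ∃ p : Polynomial ℂ, ∀ x, p.eval x = ev2 P x d := by
  refine ⟨MvPolynomial.aeval ![Polynomial.X, Polynomial.C d] P, fun x => ?_⟩
  rw [← Polynomial.coe_evalRingHom, MvPolynomial.aeval_def, MvPolynomial.hom_eval₂, ev2,
    MvPolynomial.eval, MvPolynomial.coe_eval₂Hom]
  congr 1
  · ext z
    simp
  · funext i
    fin_cases i <;> simp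

/-- A complex polynomial vanishing at all natural multiples of a nonzero number is zero. -/
theorem eq_zero_of_eval_natCast_mul (p : Polynomial ℂ) {d : ℂ} (hd : d ≠ 0)
    (hp : ∀ n : ℕ, p.eval (n * d) = 0) : p = 0 := by
  refine Polynomial.eq_zero_of_infinite_isRoot p
    ((Set.infinite_range_of_injective (f := fun n : ℕ => (n : ℂ) * d) ?_).mono ?_)
  · intro m n hmn
    exact_mod_cast mul_right_cancel₀ hd hmn
  · rintro _ ⟨n, rfl⟩
    exact hp n

/-- The homogeneous functional equation has no nonzero solution that is polynomial in the first
variable. -/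
theorem eq_zero_of_homogeneous_equation (f : ℂ → ℂ → ℂ)
    (hpoly : ∀ d, ∃ p : Polynomial ℂ, ∀ x, p.eval x = f x d)
    (hf : ∀ l m d : ℂ,
      m * f (l + m) d - (4 * l + m + d) * f m d + (l + d) * f m (l + d) = 0) (x d : ℂ) :
    f x d = 0 := by
  have shift : ∀ m d, m * f (m - d) d = (m - 3 * d) * f m d := fun m d => by
    have := hf (-d) m d
    rw [neg_add_cancel, neg_add_eq_sub] at this
    linear_combination this
  have f_zero : ∀ d, d ≠ 0 → f 0 d = 0 := fun d hd => by
    have := shift 0 d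
    have h3 : (0 - 3 * d) * f 0 d = 0 := by linear_combination -this
    simpa [hd] using h3
  have f_self : ∀ d, d ≠ 0 → f d d = 0 := fun d hd => by
    have := shift d d
    rw [sub_self, f_zero d hd] at this
    have h2 : d * f d d = 0 := by linear_combination this / 2
    simpa [hd] using h2
  have f_two : ∀ d, d ≠ 0 → f (2 * d) d = 0 := fun d hd => by
    have := shift (2 * d) d
    rw [show 2 * d - d = d by ring, f_self d hd] at this
    have h1 : d * f (2 * d) d = 0 := by linear_combination this
    simpa [hd] using h1
  have f_three : ∀ d, d ≠ 0 → f (3 * d) d = 0 := fun d hd => by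
    have := hf d (2 * d) d
    rw [show d + 2 * d = 3 * d by ring, ← two_mul, f_two d hd,
      f_self (2 * d) (mul_ne_zero two_ne_zero hd)] at this
    simpa [hd] using this
  have f_nat : ∀ d, d ≠ 0 → ∀ n : ℕ, f ((n + 3 : ℕ) * d) d = 0 := fun d hd n => by
    induction n with
    | zero => simpa using f_three d hd
    | succ n ih =>
      have := shift ((n + 1 + 3 : ℕ) * d) d
      rw [show ((n + 1 + 3 : ℕ) : ℂ) * d - d = (n + 3 : ℕ) * d by push_cast; ring, ih] at this
      have h1 : (((n + 1 : ℕ) : ℂ) * d) * f ((n + 1 + 3 : ℕ) * d) d = 0 := by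
        push_cast at this ⊢
        linear_combination -this
      exact (mul_eq_zero.mp h1).resolve_left (mul_ne_zero (Nat.cast_ne_zero.mpr n.succ_ne_zero) hd)
  have f_ne : ∀ d, d ≠ 0 → ∀ x, f x d = 0 := fun d hd x => by
    obtain ⟨p, hp⟩ := hpoly d
    rw [← hp, eq_zero_of_eval_natCast_mul p hd, Polynomial.eval_zero]
    intro n
    rw [hp]
    match n with
    | 0 => simpa using f_zero d hd
    | 1 => simpa using f_self d hd
    | 2 => simpa using f_two d hd
    | n + 3 => exact f_nat d hd n
  rcases eq_or_ne d 0 with rfl | hd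
  · rcases eq_or_ne x 0 with rfl | hx
    · simpa [f_ne 1 one_ne_zero] using hf 1 0 0
    · have := hf (-x / 3) (4 * x / 3) 0
      rw [show -x / 3 + 4 * x / 3 = x by ring, add_zero (-x / 3),
        f_ne (-x / 3) (div_ne_zero (neg_ne_zero.mpr hx) three_ne_zero)] at this
      have h1 : x * f x 0 = 0 := by linear_combination (3 / 4) * this
      exact (mul_eq_zero.mp h1).resolve_left hx
  · exact f_ne d hd x

theorem stmt13 (b c k : ℂ) (h : MvPolynomial (Fin 2) ℂ)
    (heq : ∀ lam mu d : ℂ,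
      mu * ev2 h (lam + mu) d - (4 * lam + mu + d) * ev2 h mu d
        + (lam + d) * ev2 h mu (lam + d)
      = -3 * b * lam ^ 2 * mu * d + 3 * c ^ 2 * lam ^ 2 * mu ^ 2 + k * lam ^ 3 * mu) :
    ∀ lam d : ℂ, ev2 h lam d
      = (1 / 2) * (k - b - c ^ 2) * lam * d ^ 2
        - (3 / 2) * (k - c ^ 2 + b) * lam ^ 2 * d
        + (1 / 2) * (k + b + c ^ 2) * lam ^ 3 := by
  intro lam d
  rw [← sub_eq_zero]
  refine eq_zero_of_homogeneous_equation (fun x y => ev2 h x y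
      - ((1 / 2) * (k - b - c ^ 2) * x * y ^ 2 - (3 / 2) * (k - c ^ 2 + b) * x ^ 2 * y
        + (1 / 2) * (k + b + c ^ 2) * x ^ 3)) (fun y => ?_) (fun l m y => ?_) lam d
  · obtain ⟨p, hp⟩ := exists_polynomial_eval_eq_ev2 h y
    refine ⟨p - (Polynomial.C ((1 / 2) * (k - b - c ^ 2) * y ^ 2) * Polynomial.X
      - Polynomial.C ((3 / 2) * (k - c ^ 2 + b) * y) * Polynomial.X ^ 2
      + Polynomial.C ((1 / 2) * (k + b + c ^ 2)) * Polynomial.X ^ 3), fun x => ?_⟩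
    simp only [Polynomial.eval_sub, Polynomial.eval_add, Polynomial.eval_mul, Polynomial.eval_C,
      Polynomial.eval_pow, Polynomial.eval_X, hp]
    ring
  · linear_combination heq l m y
end

section
/- Let b, c, k ∈ ℂ and let f ∈ ℂ[x,y] be a polynomial such that for all λ, μ, ∂ ∈ ℂ: f(μ, λ+∂) = −(λ + 2μ + ∂)·((k + b − c²)·(λ² + ∂²) + (3c² − 3k − 5b)·λ·∂). Then k = c² − (7/5)·b and f(λ, ∂) = (2b/5)·(∂³ + 2λ·∂²) for all λ, ∂ ∈ ℂ. -/
open MvPolynomial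

theorem stmt15 (b c k : ℂ) (f : MvPolynomial (Fin 2) ℂ)
    (heq : ∀ lam mu d : ℂ,
      ev2 f mu (lam + d)
        = -(lam + 2 * mu + d) * ((k + b - c ^ 2) * (lam ^ 2 + d ^ 2)
            + (3 * c ^ 2 - 3 * k - 5 * b) * lam * d)) :
    k = c ^ 2 - (7 / 5) * b ∧
      ∀ lam d : ℂ, ev2 f lam d = (2 * b / 5) * (d ^ 3 + 2 * lam * d ^ 2) := by
  have hk : k = c ^ 2 - (7 / 5) * b := by
    have h₁ := heq 1 0 1
    have h₂ := heq 0 0 (1 + 1)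
    rw [zero_add, h₁] at h₂
    linear_combination (1 / 10) * h₂
  refine ⟨hk, fun lam d => ?_⟩
  have h := heq 0 lam d
  rw [zero_add] at h
  rw [h, hk]
  ring
end

section
/- Let b, c, t ∈ ℂ and let f ∈ ℂ[x,y] be a polynomial such that for all λ, μ, ∂ ∈ ℂ: (λ + ∂)·f(μ, λ+∂) − (2λ − μ)·f(λ+μ, ∂) − (3λ + μ + ∂)·f(μ, ∂) = −λ²·(λ + 2μ + ∂)·(b·c·(λ² + λμ + μ² − 3λ∂ + μ∂ + ∂²) + 2t·(∂² + λ∂)). Then f(λ, ∂) = −b·c·(∂⁴ + 3λ·∂³ + 3λ²·∂² + 2λ³·∂) for all λ, ∂ ∈ ℂ, and t = (3/2)·b·c. -/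
open MvPolynomial

/-- A complex polynomial satisfying the Euler identity of degree `n` is a multiple of `X ^ n`. -/
theorem eval_eq_mul_pow_of_euler (n : ℕ) (q : Polynomial ℂ)
    (h : ∀ x : ℂ, x * q.derivative.eval x = n * q.eval x) :
    ∀ x : ℂ, q.eval x = q.coeff n * x ^ n := by
  have hq : Polynomial.X * q.derivative = Polynomial.C (n : ℂ) * q :=
    Polynomial.funext fun x => by simpa using h x
  have hm : q = Polynomial.monomial n (q.coeff n) := by
    ext k
    rw [Polynomial.coeff_monomial]
    split_ifs with hk
    · rw [hk]
    · have hc := congrArg (fun p => Polynomial.coeff p k) hq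
      cases k with
      | zero =>
        simp only [Polynomial.mul_coeff_zero, Polynomial.coeff_X_zero, Polynomial.coeff_C_zero,
          zero_mul] at hc
        exact (mul_eq_zero.mp hc.symm).resolve_left (Nat.cast_ne_zero.mpr hk)
      | succ k =>
        simp only [Polynomial.coeff_C_mul, Polynomial.coeff_X_mul,
          Polynomial.coeff_derivative] at hc
        have hz : ((n : ℂ) - ((k + 1 : ℕ) : ℂ)) * q.coeff (k + 1) = 0 := by
          push_cast
          linear_combination -hc
        exact (mul_eq_zero.mp hz).resolve_left (sub_ne_zero.mpr (Nat.cast_injective.ne hk))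
  intro x
  conv_lhs => rw [hm]
  simp

/-- Evaluating the variables of a bivariate polynomial at univariate ones. -/
theorem eval_aeval_eq_ev2 (f : MvPolynomial (Fin 2) ℂ) (p q : Polynomial ℂ) (x : ℂ) :
    (MvPolynomial.aeval ![p, q] f).eval x = ev2 f (p.eval x) (q.eval x) := by
  unfold ev2
  induction f using MvPolynomial.induction_on with
  | C a => simp
  | add f g hf hg => simp [hf, hg]
  | mul_X f i hf => fin_cases i <;> simp [hf]

theorem stmt16 (b c t : ℂ) (f : MvPolynomial (Fin 2) ℂ)
    (heq : ∀ lam mu d : ℂ,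
      (lam + d) * ev2 f mu (lam + d) - (2 * lam - mu) * ev2 f (lam + mu) d
        - (3 * lam + mu + d) * ev2 f mu d
      = -lam ^ 2 * (lam + 2 * mu + d) *
          (b * c * (lam ^ 2 + lam * mu + mu ^ 2 - 3 * lam * d + mu * d + d ^ 2)
            + 2 * t * (d ^ 2 + lam * d))) :
    (∀ lam d : ℂ, ev2 f lam d
        = -(b * c) * (d ^ 4 + 3 * lam * d ^ 3 + 3 * lam ^ 2 * d ^ 2 + 2 * lam ^ 3 * d)) ∧
      t = (3 / 2) * b * c := by
  obtain ⟨a, ha⟩ : ∃ a : ℂ, ∀ y : ℂ, ev2 f 0 y = a * y ^ 4 := by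
    set q : Polynomial ℂ := MvPolynomial.aeval ![0, Polynomial.X] f with hq
    have hqe : ∀ y, q.eval y = ev2 f 0 y := fun y => by simp [hq, eval_aeval_eq_ev2]
    refine ⟨q.coeff 4, fun y => ?_⟩
    rw [← hqe]
    refine eval_eq_mul_pow_of_euler 4 q (fun d => ?_) y
    set P : Polynomial ℂ := MvPolynomial.aeval ![Polynomial.X, Polynomial.C d] f with hP
    have hPe : ∀ x, P.eval x = ev2 f x d := fun x => by simp [hP, eval_aeval_eq_ev2]
    have key : (Polynomial.X + Polynomial.C d) * q.comp (Polynomial.X + Polynomial.C d)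
        - 2 * Polynomial.X * P - (3 * Polynomial.X + Polynomial.C d) * Polynomial.C (q.eval d)
        = Polynomial.X ^ 2 * (-(Polynomial.X + Polynomial.C d) *
          (Polynomial.C (b * c) * (Polynomial.X ^ 2 - 3 * Polynomial.X * Polynomial.C d
            + Polynomial.C d ^ 2)
            + 2 * Polynomial.C t * (Polynomial.C d ^ 2 + Polynomial.X * Polynomial.C d))) := by
      refine Polynomial.funext fun x => ?_
      have h := heq x 0 d
      simp only [add_zero, sub_zero] at h
      simp [hqe, hPe]
      linear_combination h
    have hder := congrArg (fun p => p.derivative.eval 0) key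
    simp [Polynomial.derivative_comp, hPe] at hder
    rw [← hqe] at hder
    push_cast
    linear_combination hder
  have hf : ∀ x d : ℂ, x ≠ 0 → ev2 f x d = (a * ((x + d) ^ 5 - (3 * x + d) * d ^ 4)
      + x ^ 2 * (x + d) * (b * c * (x ^ 2 - 3 * x * d + d ^ 2)
        + 2 * t * (d ^ 2 + x * d))) / (2 * x) := by
    intro x d hx
    have h := heq x 0 d
    simp only [add_zero, sub_zero, ha] at h
    rw [eq_div_iff (by simpa using hx)]
    linear_combination -h
  have h₁ := heq 1 1 0
  have h₂ := heq 1 1 1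
  norm_num [hf] at h₁ h₂
  have hac : a = -(b * c) := by grind
  have ht : t = (3 / 2) * b * c := by grind
  refine ⟨fun x d => ?_, ht⟩
  rcases eq_or_ne x 0 with rfl | hx
  · rw [ha, hac]
    ring
  · rw [hf x d hx, hac, ht]
    field_simp
    ring
end

section
/- Let a₀, a₂, b, b₂ ∈ ℂ, and consider in the polynomial ring ℂ[λ, μ, ∂] the polynomials l₂ = −(1/5)·λ²·((15b − 10a₀)λ² + (51b − 25a₀ + 15a₂)λμ + (24b − 10a₀)λ∂ + (15b − 15a₀ + 35a₂)μ∂ − 10a₂∂²) and l₄ = (1/5)·λ²·(b²λ⁴ + 4b²λ³μ + (4b² − 5b₂)λ²μ² + (4b² − 5b₂)λμ³ − b²λ³∂ − (2b² + 5b·a₂)λ²μ∂ + (3b² − 5b·a₀ − 20b₂)λμ²∂ − (b² + 5b·a₀ + 15b₂)μ³∂ + (6b² + 10b₂)λ²∂² + (26b² − 10b·a₂ + 25b₂)λμ∂² − (b² + 5b·a₀ + 15b₂)μ²∂² + (11b² + 10b₂)λ∂³ + (6b² − 5b·a₂ + 15b₂)μ∂³). If the polynomial 2λ + 5μ + 2∂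 divides both l₂ and l₄ in ℂ[λ, μ, ∂], then b = 0. -/
open MvPolynomial

theorem stmt17 (a₀ a₂ b b₂ : ℂ)
    (hdvd2 : (C 2 * X 0 + C 5 * X 1 + C 2 * X 2 : MvPolynomial (Fin 3) ℂ) ∣
      (C (-(1 / 5)) * X 0 ^ 2 *
        (C (15 * b - 10 * a₀) * X 0 ^ 2
          + C (51 * b - 25 * a₀ + 15 * a₂) * X 0 * X 1
          + C (24 * b - 10 * a₀) * X 0 * X 2
          + C (15 * b - 15 * a₀ + 35 * a₂) * X 1 * X 2
          - C (10 * a₂) * X 2 ^ 2)))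
    (hdvd4 : (C 2 * X 0 + C 5 * X 1 + C 2 * X 2 : MvPolynomial (Fin 3) ℂ) ∣
      (C (1 / 5) * X 0 ^ 2 *
        (C (b ^ 2) * X 0 ^ 4
          + C (4 * b ^ 2) * X 0 ^ 3 * X 1
          + C (4 * b ^ 2 - 5 * b₂) * X 0 ^ 2 * X 1 ^ 2
          + C (4 * b ^ 2 - 5 * b₂) * X 0 * X 1 ^ 3
          - C (b ^ 2) * X 0 ^ 3 * X 2
          - C (2 * b ^ 2 + 5 * b * a₂) * X 0 ^ 2 * X 1 * X 2
          + C (3 * b ^ 2 - 5 * b * a₀ - 20 * b₂) * X 0 * X 1 ^ 2 * X 2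
          - C (b ^ 2 + 5 * b * a₀ + 15 * b₂) * X 1 ^ 3 * X 2
          + C (6 * b ^ 2 + 10 * b₂) * X 0 ^ 2 * X 2 ^ 2
          + C (26 * b ^ 2 - 10 * b * a₂ + 25 * b₂) * X 0 * X 1 * X 2 ^ 2
          - C (b ^ 2 + 5 * b * a₀ + 15 * b₂) * X 1 ^ 2 * X 2 ^ 2
          + C (11 * b ^ 2 + 10 * b₂) * X 0 * X 2 ^ 3
          + C (6 * b ^ 2 - 5 * b * a₂ + 15 * b₂) * X 1 * X 2 ^ 3))) :
    b = 0 := by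
  -- At `(1, 0, -1)`, a zero of the divisor, the second dividend takes the value `-(3 / 5) * b ^ 2`.
  have h := map_dvd (eval ![(1 : ℂ), 0, -1]) hdvd4
  simp only [map_add, map_sub, map_mul, map_pow, eval_C, eval_X, Matrix.cons_val] at h
  have hdivisor : (2 * 1 + 5 * 0 + 2 * -1 : ℂ) = 0 := by norm_num
  rw [hdivisor, zero_dvd_iff] at h
  have hb : b ^ 2 = 0 := by linear_combination (-(5 / 3)) * h
  exact pow_eq_zero_iff two_ne_zero |>.mp hb
end

section
/- Let α, Δ ∈ ℂ with (α, Δ) ≠ (0, 0), let i be a natural number, and let p ∈ ℂ[x,y] be a polynomial such that for all λ, μ, ∂ ∈ ℂ: p(λ, μ+∂)·(α + ∂ + Δ·μ) = ((1 + i)·μ − λ)·p(λ+μ, ∂). Then p = 0. -/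
open MvPolynomial

theorem stmt18 (α Δ : ℂ) (hαΔ : (α, Δ) ≠ (0, 0)) (i : ℕ)
    (p : MvPolynomial (Fin 2) ℂ)
    (heq : ∀ lam mu d : ℂ,
      ev2 p lam (mu + d) * (α + d + Δ * mu)
        = ((1 + (i : ℂ)) * mu - lam) * ev2 p (lam + mu) d) :
    p = 0 := by
  have hmul : p * (C α + X 1 + X 0) = 0 := by
    refine MvPolynomial.funext fun v => ?_
    have hv : ![v 0, v 1] = v := by
      ext j
      fin_cases j <;> rfl
    have h := heq (v 0) 0 (v 1)
    simp only [ev2, zero_add, add_zero, mul_zero, zero_sub, hv] at h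
    simp only [map_mul, map_add, eval_C, eval_X, map_zero]
    linear_combination h
  refine (mul_eq_zero.mp hmul).resolve_right fun hzero => ?_
  have h := congrArg (eval ![1 - α, 0]) hzero
  simp at h
end
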